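/- arXiv:2411.09257 — 4 statements merged into one kernel-verified Lean document; each statement's English description precedes it below -/
import Mathlib

section
/- For each n ∈ ℕ₀, the function t ↦ q̂(n,t) is differentiable and satisfies d/dt q̂(n,t) = Σ_{j₀=1}^{k₀} μ_{j₀}(t)·(Σ_{r=0}^{n} p(r,j₀)·q̂(n−r,t) − q̂(n,t)), with initial condition q̂(n,0) = 1 if n = 0 and q̂(n,0) = 0 otherwise. -/
/-- GCP state probabilities: `p(n,t) = ∑_{Ω(k,n)} ∏_j ((λ_j t)^{x_j}/x_j!) e^{−λ_j t}`,
where index `j : Fin k` encodes jump size `j+1`. -/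
noncomputable def gcpPmf (k : ℕ) (lam : Fin k → ℝ) (n : ℕ) (t : ℝ) : ℝ :=
  ∑' x : Fin k → ℕ,
    if (∑ j : Fin k, ((j : ℕ) + 1) * x j) = n then
      ∏ j : Fin k, (lam j * t) ^ (x j) / (Nat.factorial (x j)) * Real.exp (-(lam j * t))
    else 0

/-- Non-homogeneous GCP state probabilities with cumulative rates `ρ_{j₀}`:
`p_ρ(m) = ∑_{Ω(k₀,m)} ∏_{j₀} (ρ_{j₀}^{x_{j₀}}/x_{j₀}!) e^{−ρ_{j₀}}`. -/
noncomputable def nhGcpPmf (k0 : ℕ) (rho : Fin k0 → ℝ) (m : ℕ) : ℝ :=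
  ∑' x : Fin k0 → ℕ,
    if (∑ j0 : Fin k0, ((j0 : ℕ) + 1) * x j0) = m then
      ∏ j0 : Fin k0, rho j0 ^ (x j0) / (Nat.factorial (x j0)) * Real.exp (-(rho j0))
    else 0

/-- Non-homogeneous IGCP state probabilities with rate functions `μ_{j₀}(·)`:
`q̂(n,t) = ∑_{m=0}^∞ p(n,m) p_ρ(m,t)` with `ρ_{j₀}(t) = ∫₀ᵗ μ_{j₀}(s) ds`. -/
noncomputable def nhIgcpPmf (k : ℕ) (lam : Fin k → ℝ) (k0 : ℕ) (mu : Fin k0 → ℝ → ℝ)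
    (n : ℕ) (t : ℝ) : ℝ :=
  ∑' m : ℕ, gcpPmf k lam n m * nhGcpPmf k0 (fun j0 => ∫ s in (0:ℝ)..t, mu j0 s) m

/-- Products of absolutely summable families over `Fin k → ℕ`. -/
theorem hasSum_pi_prod {A : Type*} [NormedCommRing A] [CompleteSpace A] :
    ∀ (k : ℕ) (f : Fin k → ℕ → A) (_ : ∀ j, Summable (fun i => ‖f j i‖)),
      Summable (fun x : Fin k → ℕ => ‖∏ j, f j (x j)‖) ∧
      HasSum (fun x : Fin k → ℕ => ∏ j, f j (x j)) (∏ j, ∑' i, f j i) := by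
  intro k
  induction k with
  | zero =>
    intro f _
    refine ⟨(hasSum_unique _).summable, ?_⟩
    simpa using hasSum_unique (fun x : Fin 0 → ℕ => ∏ j, f j (x j))
  | succ k ih =>
    intro f hf
    obtain ⟨h1, h2⟩ := ih (fun j => f j.succ) (fun j => hf j.succ)
    have hs := (hf 0).mul_norm h1
    have hh : HasSum (fun y : ℕ × (Fin k → ℕ) => f 0 y.1 * ∏ j : Fin k, f j.succ (y.2 j))
        ((∑' i, f 0 i) * ∏ j : Fin k, ∑' i, f j.succ i) := by
      have := (hf 0).of_norm.hasSum.mul h2 hs.of_norm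
      exact this
    constructor
    · rw [← (Fin.consEquiv (fun _ : Fin (k+1) => ℕ)).summable_iff]
      refine hs.congr fun y => ?_
      simp [Fin.prod_univ_succ, Fin.consEquiv]
    · rw [← (Fin.consEquiv (fun _ : Fin (k+1) => ℕ)).hasSum_iff, Fin.prod_univ_succ]
      convert! hh using 1
      funext y
      simp [Fin.prod_univ_succ, Fin.consEquiv]

/-- The expansion of a multivariate Poisson exponential in a commutative Banach algebra. -/
theorem hasSum_poisson {A : Type*} [NormedCommRing A] [NormedAlgebra ℝ A] [CompleteSpace A]
    (k : ℕ) (a : Fin k → ℝ) (y : A) :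
    HasSum (fun x : Fin k → ℕ =>
        (∏ j, a j ^ (x j) / (Nat.factorial (x j)) * Real.exp (-(a j))) •
          y ^ (∑ j : Fin k, ((j : ℕ) + 1) * x j))
      (NormedSpace.exp (∑ j : Fin k, a j • (y ^ ((j : ℕ) + 1) - 1))) := by
  letI : NormedAlgebra ℚ A := NormedAlgebra.restrictScalars ℚ ℝ A
  have hf : ∀ j : Fin k, HasSum (fun i : ℕ => (a j ^ i / (Nat.factorial i) * Real.exp (-(a j))) •
      (y ^ ((j : ℕ) + 1)) ^ i) (NormedSpace.exp (a j • (y ^ ((j : ℕ) + 1) - 1))) := by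
    intro j
    have h := (NormedSpace.exp_series_hasSum_exp' (𝕂 := ℝ) (a j • y ^ ((j : ℕ) + 1))).const_smul
      (Real.exp (-(a j)))
    convert! h using 1
    · funext i
      rw [smul_pow, smul_smul, smul_smul]
      congr 1
      ring
    · rw [smul_sub, sub_eq_add_neg, NormedSpace.exp_add, mul_comm, ← smul_neg]
      have : NormedSpace.exp (a j • (-1 : A)) = algebraMap ℝ A (Real.exp (-(a j))) := by
        rw [Real.exp_eq_exp_ℝ, NormedSpace.algebraMap_exp_comm, Algebra.algebraMap_eq_smul_one]
        simp
      rw [this, ← Algebra.smul_def]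
  have hn : ∀ j : Fin k, Summable (fun i : ℕ =>
      ‖(a j ^ i / (Nat.factorial i) * Real.exp (-(a j))) • (y ^ ((j : ℕ) + 1)) ^ i‖) := by
    intro j
    have h := (NormedSpace.norm_expSeries_summable' (𝕂 := ℝ) (a j • y ^ ((j : ℕ) + 1))).mul_left
      ‖Real.exp (-(a j))‖
    refine h.congr fun i => ?_
    rw [← norm_smul]
    congr 1
    rw [smul_pow, smul_smul, smul_smul]
    congr 1
    ring
  have h := (hasSum_pi_prod k _ hn).2
  rw [NormedSpace.exp_sum]
  simp_rw [(hf _).tsum_eq] at h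
  convert! h using 1
  funext x
  rw [Finset.prod_smul]
  congr 1
  simp_rw [← pow_mul]
  rw [Finset.prod_pow_eq_pow_sum]

section abstractAlgebra

variable {A : Type*} [NormedCommRing A] [NormedAlgebra ℝ A] [CompleteSpace A]

theorem coeff_mul_closure (z : A) (c : ℕ → A →L[ℝ] ℝ)
    (hc : ∀ n s, c n (z ^ s) = if s = n then 1 else 0) (n : ℕ) (F G : A)
    (hF : F ∈ (Algebra.adjoin ℝ {z}).topologicalClosure)
    (hG : G ∈ (Algebra.adjoin ℝ {z}).topologicalClosure) :
    c n (F * G) = ∑ r ∈ Finset.range (n + 1), c r F * c (n - r) G := by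
  have hp : ∀ (m : ℕ) (p : Polynomial ℝ), c m (Polynomial.aeval z p) = p.coeff m := by
    intro m p
    rw [Polynomial.aeval_eq_sum_range, map_sum]
    simp only [map_smul, hc, smul_eq_mul, mul_ite, mul_one, mul_zero]
    rw [Finset.sum_ite_eq']
    split_ifs with h
    · rfl
    · exact (Polynomial.coeff_eq_zero_of_natDegree_lt (by simpa using h)).symm
  have h0 : ∀ F ∈ Algebra.adjoin ℝ {z}, ∀ G ∈ Algebra.adjoin ℝ {z},
      c n (F * G) = ∑ r ∈ Finset.range (n + 1), c r F * c (n - r) G := by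
    intro F hF G hG
    rw [Algebra.adjoin_singleton_eq_range_aeval] at hF hG
    obtain ⟨p, rfl⟩ := hF
    obtain ⟨q, rfl⟩ := hG
    change c n (Polynomial.aeval z p * Polynomial.aeval z q) = ∑ r ∈ Finset.range (n + 1),
      c r (Polynomial.aeval z p) * c (n - r) (Polynomial.aeval z q)
    rw [← map_mul, hp]
    simp only [hp]
    rw [Polynomial.coeff_mul, Finset.Nat.sum_antidiagonal_eq_sum_range_succ_mk]
  have h1 : ∀ F ∈ Algebra.adjoin ℝ {z}, ∀ G ∈ (Algebra.adjoin ℝ {z}).topologicalClosure,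
      c n (F * G) = ∑ r ∈ Finset.range (n + 1), c r F * c (n - r) G := by
    intro F hF G hG
    have : Set.EqOn (fun G => c n (F * G))
        (fun G => ∑ r ∈ Finset.range (n + 1), c r F * c (n - r) G)
        (Algebra.adjoin ℝ {z} : Set A) := fun G hG => h0 F hF G hG
    exact this.closure (by fun_prop) (by fun_prop) hG
  have : Set.EqOn (fun F => c n (F * G))
      (fun F => ∑ r ∈ Finset.range (n + 1), c r F * c (n - r) G)
      (Algebra.adjoin ℝ {z} : Set A) := fun F hF => h1 F hF G hG
  exact this.closure (by fun_prop) (by fun_prop) hF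

theorem exp_mem_adj (S : Subalgebra ℝ A) (hS : IsClosed (S : Set A)) (x : A) (hx : x ∈ S) :
    NormedSpace.exp x ∈ S := by
  refine hS.mem_of_tendsto (NormedSpace.exp_series_hasSum_exp' (𝕂 := ℝ) x)
    (Filter.Eventually.of_forall fun s => ?_)
  exact S.sum_mem fun i _ => S.smul_mem (S.pow_mem hx i) _

theorem nhGcp_eq (z : A) (c : ℕ → A →L[ℝ] ℝ)
    (hc : ∀ n s, c n (z ^ s) = if s = n then 1 else 0) (k : ℕ) (a : Fin k → ℝ) (n : ℕ) :
    nhGcpPmf k a n = c n (NormedSpace.exp (∑ j : Fin k, a j • (z ^ ((j : ℕ) + 1) - 1))) := by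
  have h := (c n).hasSum (hasSum_poisson k a z)
  rw [← h.tsum_eq, nhGcpPmf]
  refine tsum_congr fun x => ?_
  simp [hc]

/-- The one-step GCP generating element. -/
noncomputable def gcpGen (k : ℕ) (lam : Fin k → ℝ) (z : A) : A :=
  NormedSpace.exp (∑ j : Fin k, lam j • (z ^ ((j : ℕ) + 1) - 1))

theorem gcp_eq (z : A) (c : ℕ → A →L[ℝ] ℝ)
    (hc : ∀ n s, c n (z ^ s) = if s = n then 1 else 0) (k : ℕ) (lam : Fin k → ℝ) (n m : ℕ) :
    gcpPmf k lam n m = c n (gcpGen k lam z ^ m) := by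
  letI : NormedAlgebra ℚ A := NormedAlgebra.restrictScalars ℚ ℝ A
  have h := nhGcp_eq z c hc k (fun j => lam j * m) n
  have h' : gcpPmf k lam n m = nhGcpPmf k (fun j => lam j * m) n := rfl
  rw [h', h, gcpGen, ← NormedSpace.exp_nsmul, Finset.smul_sum]
  congr 3
  funext j
  rw [← Nat.cast_smul_eq_nsmul ℝ, smul_smul, mul_comm]

theorem nhIgcp_eq (z : A) (c : ℕ → A →L[ℝ] ℝ)
    (hc : ∀ n s, c n (z ^ s) = if s = n then 1 else 0) (k : ℕ) (lam : Fin k → ℝ)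
    (k0 : ℕ) (a : Fin k0 → ℝ) (n : ℕ) :
    ∑' m : ℕ, gcpPmf k lam n m * nhGcpPmf k0 a m =
      c n (NormedSpace.exp (∑ j : Fin k0, a j • (gcpGen k lam z ^ ((j : ℕ) + 1) - 1))) := by
  have h := (c n).hasSum (hasSum_poisson k0 a (gcpGen k lam z))
  have h2 := h.tsum_fiberwise (fun x : Fin k0 → ℕ => ∑ j : Fin k0, ((j : ℕ) + 1) * x j)
  rw [← h2.tsum_eq]
  refine tsum_congr fun m => ?_
  rw [nhGcpPmf, ← tsum_mul_left]
  refine Eq.trans ?_ (tsum_subtype _ (fun b : Fin k0 → ℕ =>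
    (c n) ((∏ j, a j ^ b j / (Nat.factorial (b j)) * Real.exp (-a j)) •
      gcpGen k lam z ^ ∑ j : Fin k0, ((j : ℕ) + 1) * b j))).symm
  refine tsum_congr fun x => ?_
  classical
  rw [Set.indicator_apply]
  by_cases hx : (∑ j : Fin k0, ((j : ℕ) + 1) * x j) = m
  · simp only [hx, gcp_eq z c hc, Set.mem_preimage, Set.mem_singleton_iff, if_true, map_smul,
      smul_eq_mul]
    exact mul_comm _ _
  · simp [hx]

theorem nhIgcp_de_abs (z : A) (c : ℕ → A →L[ℝ] ℝ)
    (hc : ∀ n s, c n (z ^ s) = if s = n then 1 else 0)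
    (k : ℕ) (lam : Fin k → ℝ) (k0 : ℕ) (mu : Fin k0 → ℝ → ℝ)
    (hmucont : ∀ j0, Continuous (mu j0)) (n : ℕ) :
    (∀ t : ℝ,
      HasDerivAt (fun τ : ℝ => nhIgcpPmf k lam k0 mu n τ)
        (∑ j0 : Fin k0, mu j0 t *
          ((∑ r ∈ Finset.range (n + 1),
              gcpPmf k lam r (((j0 : ℕ) + 1 : ℝ)) * nhIgcpPmf k lam k0 mu (n - r) t) -
            nhIgcpPmf k lam k0 mu n t)) t) ∧
    nhIgcpPmf k lam k0 mu n 0 = if n = 0 then 1 else 0 := by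
  have hq : ∀ n t, nhIgcpPmf k lam k0 mu n t = c n (NormedSpace.exp
      (∑ j : Fin k0, (∫ s in (0:ℝ)..t, mu j s) • (gcpGen k lam z ^ ((j : ℕ) + 1) - 1))) :=
    fun n t => nhIgcp_eq z c hc k lam k0 _ n
  set S := (Algebra.adjoin ℝ {z}).topologicalClosure with hS
  have hScl : IsClosed (S : Set A) := Subalgebra.isClosed_topologicalClosure _
  have hz : z ∈ S := Subalgebra.le_topologicalClosure _ (Algebra.self_mem_adjoin_singleton ℝ z)
  have hG : gcpGen k lam z ∈ S := exp_mem_adj S hScl _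
    (S.sum_mem fun j _ => S.smul_mem (S.sub_mem (S.pow_mem hz _) S.one_mem) _)
  constructor
  · intro t
    simp only [hq]
    have hQ : NormedSpace.exp
      (∑ j : Fin k0, (∫ s in (0:ℝ)..t, mu j s) • (gcpGen k lam z ^ ((j : ℕ) + 1) - 1)) ∈ S :=
      exp_mem_adj S hScl _
        (S.sum_mem fun j _ => S.smul_mem (S.sub_mem (S.pow_mem hG _) S.one_mem) _)
    have hd : HasDerivAt (fun τ : ℝ => ∑ j : Fin k0, (∫ s in (0:ℝ)..τ, mu j s) •
        (gcpGen k lam z ^ ((j : ℕ) + 1) - 1))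
        (∑ j : Fin k0, mu j t • (gcpGen k lam z ^ ((j : ℕ) + 1) - 1)) t := by
      refine HasDerivAt.fun_sum fun j _ => ?_
      exact ((hmucont j).integral_hasStrictDerivAt 0 t).hasDerivAt.smul_const _
    have h1 := (hasFDerivAt_exp (𝕂 := ℝ)).comp_hasDerivAt t hd
    have h2 := (c n).hasFDerivAt.comp_hasDerivAt t h1
    convert! h2 using 1
    simp only [ContinuousLinearMap.smul_apply, ContinuousLinearMap.one_apply, smul_eq_mul,
      Finset.mul_sum, map_sum, mul_smul_comm, map_smul]
    refine Finset.sum_congr rfl fun j _ => ?_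
    congr 1
    rw [mul_sub, mul_one, map_sub, mul_comm, coeff_mul_closure z c hc n _ _ (S.pow_mem hG _) hQ]
    congr 1
    refine Finset.sum_congr rfl fun r _ => ?_
    have := gcp_eq z c hc k lam r ((j : ℕ) + 1)
    push_cast at this
    rw [this]
  · rw [hq]
    have := hc n 0
    simp only [pow_zero] at this
    simp [NormedSpace.exp_zero, this, eq_comm]

end abstractAlgebra

theorem exists_coeff_functionals :
    ∃ (z : C(UnitAddCircle, ℂ)) (c : ℕ → C(UnitAddCircle, ℂ) →L[ℝ] ℝ),
      ∀ n s, c n (z ^ s) = if s = n then 1 else 0 := by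
  refine ⟨fourier 1, fun n => Complex.reCLM.comp (ContinuousLinearMap.restrictScalars ℝ
    ((innerSL ℂ (fourierLp (T := 1) 2 (n : ℤ))).comp
      (ContinuousMap.toLp (E := ℂ) 2 AddCircle.haarAddCircle ℂ))), fun n s => ?_⟩
  have hpow : (fourier 1 : C(UnitAddCircle, ℂ)) ^ s = fourier (s : ℤ) := by
    induction s with
    | zero => ext x; simp
    | succ s ih => rw [pow_succ, ih]; ext x; push_cast; exact fourier_add.symm
  have h := orthonormal_iff_ite.1 (orthonormal_fourier (T := 1)) (n : ℤ) (s : ℤ)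
  rw [hpow]
  change (inner ℂ (fourierLp (T := 1) 2 (n : ℤ)) (fourierLp (T := 1) 2 (s : ℤ))).re = _
  rw [h]
  by_cases hns : s = n
  · simp [hns]
  · have : ¬ n = s := fun h => hns h.symm
    simp [hns, this]

/-- the system of differential equations governing the state
probabilities of the non-homogeneous IGCP, with initial condition. -/
theorem nhIgcp_de (k : ℕ) (hk : 0 < k) (lam : Fin k → ℝ) (hlam : ∀ j, 0 < lam j)
    (k0 : ℕ) (hk0 : 0 < k0) (mu : Fin k0 → ℝ → ℝ)
    (hmucont : ∀ j0, Continuous (mu j0)) (hmupos : ∀ j0, ∀ s : ℝ, 0 ≤ s → 0 ≤ mu j0 s)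
    (n : ℕ) :
    (∀ t : ℝ, 0 ≤ t →
      HasDerivAt (fun τ : ℝ => nhIgcpPmf k lam k0 mu n τ)
        (∑ j0 : Fin k0, mu j0 t *
          ((∑ r ∈ Finset.range (n + 1),
              gcpPmf k lam r (((j0 : ℕ) + 1 : ℝ)) * nhIgcpPmf k lam k0 mu (n - r) t) -
            nhIgcpPmf k lam k0 mu n t)) t) ∧
    nhIgcpPmf k lam k0 mu n 0 = if n = 0 then 1 else 0 := by
  obtain ⟨z, c, hc⟩ := exists_coeff_functionals
  obtain ⟨h1, h2⟩ := nhIgcp_de_abs z c hc k lam k0 mu hmucont n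
  exact ⟨fun t _ => h1 t, h2⟩
end

section
/- For each n̄ ∈ ℕ₀^q, the function t ↦ p̂(n̄,t) is differentiable and satisfies d/dt p̂(n̄,t) = −Σ_{j₀=1}^{k₀} μ_{j₀}(1 − e^{−j₀Λ}) p̂(n̄,t) + Σ_{m̄} p̂(n̄−m̄,t) Σ_{j₀=1}^{k₀} μ_{j₀} e^{−j₀Λ} Σ over tuples ((x_{i1},…,x_{ik_i}) ∈ Ω(k_i,m_i) for each i) of Π_{i=1}^q Π_{j_i=1}^{k_i} (j₀λ_{ij_i})^{x_{ij_i}}/x_{ij_i}!, where the outer sum is over m̄ ∈ ℕ₀^q with m̄ ≤ n̄ componentwise and m̄ ≠ 0̄; the initial condition is p̂(n̄,0) = 1 if n̄ = 0̄ and 0 otherwise. -/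
/-- Multivariate IGCP state probabilities:
`p̂(n̄,t) = ∑_{m=0}^∞ (∏_i p_i(n_i,m)) p₀(m,t)`. -/
noncomputable def mvIgcpPmf (q : ℕ) (K : Fin q → ℕ) (L : (i : Fin q) → Fin (K i) → ℝ)
    (k0 : ℕ) (mu : Fin k0 → ℝ) (n : Fin q → ℕ) (t : ℝ) : ℝ :=
  ∑' m : ℕ, (∏ i : Fin q, gcpPmf (K i) (L i) (n i) m) * gcpPmf k0 mu m t

namespace IgcpAux
open PowerSeries

/-- The series `exp (c X^(j+1))`. -/
noncomputable def E (j : ℕ) (c : ℝ) : PowerSeries ℝ :=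
  PowerSeries.expand (j + 1) (Nat.succ_ne_zero j) (PowerSeries.rescale c (PowerSeries.exp ℝ))

lemma E_add (j : ℕ) (a b : ℝ) : E j (a + b) = E j a * E j b := by
  simp only [E, ← PowerSeries.exp_mul_exp_eq_exp_add, map_mul]

lemma coeff_E_mul (j : ℕ) (c : ℝ) (r : ℕ) :
    coeff ((j + 1) * r) (E j c) = c ^ r / (Nat.factorial r) := by
  rw [E, PowerSeries.coeff_expand_mul, PowerSeries.coeff_rescale, PowerSeries.coeff_exp]
  simp [div_eq_mul_inv]

lemma coeff_E_ndvd (j : ℕ) (c : ℝ) (n : ℕ) (h : ¬ (j + 1) ∣ n) : coeff n (E j c) = 0 := by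
  rw [E, PowerSeries.coeff_expand_of_not_dvd _ _ _ h]

/-- The product of all the factors. -/
noncomputable def F {k : ℕ} (c : Fin k → ℝ) : PowerSeries ℝ := ∏ j : Fin k, E j (c j)

lemma F_add {k : ℕ} (a b : Fin k → ℝ) : F (a + b) = F a * F b := by
  simp only [F, Pi.add_apply, E_add, Finset.prod_mul_distrib]

lemma mem_box {k n : ℕ} {x : Fin k → ℕ} (h : (∑ j : Fin k, ((j : ℕ) + 1) * x j) = n) :
    x ∈ Fintype.piFinset (fun _ : Fin k => Finset.range (n + 1)) := by
  rw [Fintype.mem_piFinset]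
  intro j
  have : ((j : ℕ) + 1) * x j ≤ n := by
    rw [← h]
    exact Finset.single_le_sum (f := fun j : Fin k => ((j : ℕ) + 1) * x j)
      (fun _ _ => Nat.zero_le _) (Finset.mem_univ j)
  rw [Finset.mem_range]
  nlinarith

lemma tsum_box {k : ℕ} (n : ℕ) (f : (Fin k → ℕ) → ℝ) :
    (∑' x : Fin k → ℕ, if (∑ j : Fin k, ((j : ℕ) + 1) * x j) = n then f x else 0) =
      ∑ x ∈ Fintype.piFinset (fun _ : Fin k => Finset.range (n + 1)),
        if (∑ j : Fin k, ((j : ℕ) + 1) * x j) = n then f x else 0 := by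
  apply tsum_eq_sum
  intro x hx
  rw [if_neg]
  intro h
  exact hx (mem_box h)

lemma coeff_F {k : ℕ} (c : Fin k → ℝ) (n : ℕ) :
    coeff n (F c) = ∑' x : Fin k → ℕ, if (∑ j : Fin k, ((j : ℕ) + 1) * x j) = n then
      ∏ j : Fin k, (c j) ^ (x j) / (Nat.factorial (x j)) else 0 := by
  rw [tsum_box, ← Finset.sum_filter, F, PowerSeries.coeff_prod]
  symm
  apply Finset.sum_of_injOn
    (fun x : Fin k → ℕ => Finsupp.equivFunOnFinite.symm (fun j : Fin k => ((j : ℕ) + 1) * x j))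
  · intro x _ y _ h
    have h := Finsupp.equivFunOnFinite.symm.injective h
    funext j
    have := congrFun h j
    exact Nat.eq_of_mul_eq_mul_left (Nat.succ_pos _) this
  · intro x hx
    simp only [Finset.coe_filter, Set.mem_ofPred_eq] at hx
    simp [Finset.mem_finsuppAntidiag, hx.2]
  · intro l hl hn
    by_contra hne
    apply hn
    have hd : ∀ j : Fin k, ((j : ℕ) + 1) ∣ l j := by
      intro j
      by_contra hj
      exact hne (Finset.prod_eq_zero (Finset.mem_univ j) (coeff_E_ndvd _ _ _ hj))
    choose x hx using hd
    refine ⟨x, ?_, ?_⟩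
    · have : (∑ j : Fin k, ((j : ℕ) + 1) * x j) = n := by
        simp only [← hx]
        simpa [Finset.mem_finsuppAntidiag] using hl
      simp only [Finset.coe_filter, Set.mem_ofPred_eq]
      exact ⟨mem_box this, this⟩
    · ext j
      simp [hx]
  · intro x _
    apply Finset.prod_congr rfl
    intro j _
    simp [coeff_E_mul]

lemma gcp_eq {k : ℕ} (lam : Fin k → ℝ) (n : ℕ) (t : ℝ) :
    gcpPmf k lam n t = Real.exp (-((∑ j, lam j) * t)) * coeff n (F (fun j => lam j * t)) := by
  rw [coeff_F, gcpPmf, ← tsum_mul_left]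
  congr 1
  funext x
  split_ifs
  · rw [Finset.prod_mul_distrib, ← Real.exp_sum, Finset.sum_neg_distrib, Finset.sum_mul, mul_comm]
  · simp

lemma E_hasDeriv (j : ℕ) (l t : ℝ) (n : ℕ) :
    HasDerivAt (fun t : ℝ => coeff n (E j (l * t)))
      (coeff n (C l * X ^ (j + 1) * E j (l * t))) t := by
  rw [mul_assoc, coeff_C_mul, coeff_X_pow_mul']
  by_cases h : (j + 1) ∣ n
  · obtain ⟨r, rfl⟩ := h
    simp only [coeff_E_mul]
    cases r with
    | zero => simpa using hasDerivAt_const t (1 : ℝ)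
    | succ s =>
      rw [if_pos (by nlinarith), show (j + 1) * (s + 1) - (j + 1) = (j + 1) * s by
        rw [Nat.mul_succ]; omega, coeff_E_mul]
      have := ((((hasDerivAt_id t).const_mul l).pow (s + 1)).div_const
        ((Nat.factorial (s + 1) : ℕ) : ℝ))
      refine (this.congr_deriv ?_)
      rw [Nat.factorial_succ]
      have h1 : ((s : ℝ) + 1) ≠ 0 := by positivity
      have h2 : ((Nat.factorial s : ℕ) : ℝ) ≠ 0 := by positivity
      push_cast
      simp
      field_simp
  · simp only [coeff_E_ndvd j _ n h]
    have : (l * if j + 1 ≤ n then coeff (n - (j + 1)) (E j (l * t)) else 0) = 0 := by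
      split_ifs with h1
      · rw [coeff_E_ndvd, mul_zero]
        intro h2
        exact h ((Nat.dvd_sub_iff_left h1 dvd_rfl).1 h2)
      · simp
    rw [this]
    exact hasDerivAt_const t _

lemma mul_hasDeriv (A B : ℝ → PowerSeries ℝ) (A' B' : PowerSeries ℝ) (t : ℝ)
    (hA : ∀ n, HasDerivAt (fun t => coeff n (A t)) (coeff n A') t)
    (hB : ∀ n, HasDerivAt (fun t => coeff n (B t)) (coeff n B') t) (n : ℕ) :
    HasDerivAt (fun t => coeff n (A t * B t)) (coeff n (A' * B t + A t * B')) t := by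
  simp only [map_add, coeff_mul, ← Finset.sum_add_distrib]
  exact HasDerivAt.fun_sum (fun p _ => (hA p.1).mul (hB p.2))

lemma prod_hasDeriv {k : ℕ} (lam : Fin k → ℝ) (t : ℝ) (s : Finset (Fin k)) : ∀ n,
    HasDerivAt (fun t : ℝ => coeff n (∏ j ∈ s, E j (lam j * t)))
      (coeff n ((∑ j ∈ s, C (lam j) * X ^ ((j : ℕ) + 1)) * ∏ j ∈ s, E j (lam j * t))) t := by
  classical
  induction s using Finset.induction_on with
  | empty => intro n; simpa using hasDerivAt_const t _
  | insert a s ha ih =>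
    intro n
    simp only [Finset.prod_insert ha, Finset.sum_insert ha]
    refine (mul_hasDeriv _ _ _ _ t (E_hasDeriv a (lam a) t) ih n).congr_deriv ?_
    congr 1
    ring

/-- nonnegative coefficients with given sum -/
def S (A : PowerSeries ℝ) (v : ℝ) : Prop := (∀ n, 0 ≤ coeff n A) ∧ HasSum (fun n => coeff n A) v

lemma S_mul {A B : PowerSeries ℝ} {v w : ℝ} (hA : S A v) (hB : S B w) : S (A * B) (v * w) := by
  refine ⟨fun n => ?_, ?_⟩
  · rw [coeff_mul]
    exact Finset.sum_nonneg fun p _ => mul_nonneg (hA.1 _) (hB.1 _)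
  · have sA : Summable fun n => ‖coeff n A‖ := hA.2.summable.abs
    have sB : Summable fun n => ‖coeff n B‖ := hB.2.summable.abs
    have h1 := tsum_mul_tsum_eq_tsum_sum_antidiagonal_of_summable_norm sA sB
    have h2 := (summable_norm_sum_mul_antidiagonal_of_summable_norm sA sB).of_norm
    rw [hA.2.tsum_eq, hB.2.tsum_eq] at h1
    simp only [coeff_mul]
    rw [h1]
    exact h2.hasSum

lemma S_E (j : ℕ) (c : ℝ) (hc : 0 ≤ c) : S (E j c) (Real.exp c) := by
  constructor
  · intro n
    by_cases h : (j + 1) ∣ n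
    · obtain ⟨r, rfl⟩ := h
      rw [coeff_E_mul]; positivity
    · rw [coeff_E_ndvd j c n h]
  · have hi : Function.Injective (fun r : ℕ => (j + 1) * r) := fun a b h =>
      Nat.eq_of_mul_eq_mul_left (Nat.succ_pos _) h
    rw [← hi.hasSum_iff]
    · have : ((fun n => coeff n (E j c)) ∘ fun r : ℕ => (j + 1) * r) =
          fun r : ℕ => c ^ r / (Nat.factorial r) := by
        funext r; simp [coeff_E_mul]
      rw [this, Real.exp_eq_exp_ℝ]
      exact NormedSpace.expSeries_div_hasSum_exp c
    · intro n hn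
      apply coeff_E_ndvd
      rintro ⟨r, rfl⟩
      exact hn ⟨r, rfl⟩

lemma S_F {k : ℕ} (c : Fin k → ℝ) (hc : ∀ j, 0 ≤ c j) : S (F c) (Real.exp (∑ j, c j)) := by
  classical
  rw [F, Real.exp_sum]
  induction (Finset.univ : Finset (Fin k)) using Finset.induction_on with
  | empty =>
    refine ⟨fun n => ?_, ?_⟩
    · simp only [Finset.prod_empty, coeff_one]; split_ifs <;> norm_num
    · simp only [Finset.prod_empty, coeff_one]
      exact hasSum_ite_eq 0 1
  | insert a s ha ih =>
    rw [Finset.prod_insert ha, Finset.prod_insert ha]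
    exact S_mul (S_E _ _ (hc a)) ih

lemma abs_coeff_F_le {k : ℕ} (c d : Fin k → ℝ) (h : ∀ j, |c j| ≤ d j) (n : ℕ) :
    |coeff n (F c)| ≤ coeff n (F d) := by
  rw [coeff_F, coeff_F, tsum_box, tsum_box]
  refine (Finset.abs_sum_le_sum_abs _ _).trans (Finset.sum_le_sum fun x _ => ?_)
  split_ifs
  · rw [Finset.abs_prod]
    refine Finset.prod_le_prod (fun _ _ => abs_nonneg _) fun j _ => ?_
    rw [abs_div, abs_pow, Nat.abs_cast]
    gcongr
    exact h j
  · simp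

lemma gcp_hasDeriv {k : ℕ} (mu : Fin k → ℝ) (n : ℕ) (t : ℝ) :
    HasDerivAt (fun τ => gcpPmf k mu n τ)
      (-(∑ j, mu j) * gcpPmf k mu n t +
        ∑ j : Fin k, mu j * (if (j : ℕ) + 1 ≤ n then gcpPmf k mu (n - ((j : ℕ) + 1)) t else 0)) t := by
  simp only [gcp_eq]
  have h1 : HasDerivAt (fun τ : ℝ => Real.exp (-((∑ j, mu j) * τ)))
      (Real.exp (-((∑ j, mu j) * t)) * (-((∑ j, mu j) * 1))) t :=
    (((hasDerivAt_id t).const_mul (∑ j, mu j)).neg).exp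
  have h2 := prod_hasDeriv mu t Finset.univ n
  refine (h1.mul h2).congr_deriv ?_
  simp only [F, Finset.sum_mul, map_sum, mul_assoc, coeff_C_mul, coeff_X_pow_mul']
  rw [Finset.mul_sum]
  congr 1
  · simp only [← Finset.sum_mul]; ring
  · apply Finset.sum_congr rfl
    intro j _
    split_ifs <;> ring

lemma gcp_add {k : ℕ} (lam : Fin k → ℝ) (n : ℕ) (s t : ℝ) :
    gcpPmf k lam n (s + t) =
      ∑ l ∈ Finset.range (n + 1), gcpPmf k lam (n - l) s * gcpPmf k lam l t := by
  simp only [gcp_eq]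
  have : (fun j => lam j * (s + t)) = (fun j => lam j * t) + (fun j => lam j * s) := by
    funext j; simp; ring
  rw [this, F_add, coeff_mul, Finset.Nat.sum_antidiagonal_eq_sum_range_succ_mk, Finset.mul_sum]
  apply Finset.sum_congr rfl
  intro l _
  rw [show -((∑ j, lam j) * (s + t)) = -((∑ j, lam j) * s) + -((∑ j, lam j) * t) by ring,
    Real.exp_add]
  ring

lemma gcp_nonneg {k : ℕ} (lam : Fin k → ℝ) (hl : ∀ j, 0 < lam j) (n : ℕ) (s : ℝ) (hs : 0 ≤ s) :
    0 ≤ gcpPmf k lam n s := by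
  rw [gcp_eq]
  exact mul_nonneg (Real.exp_pos _).le ((S_F _ fun j => mul_nonneg (hl j).le hs).1 n)

lemma gcp_le_one {k : ℕ} (lam : Fin k → ℝ) (hl : ∀ j, 0 < lam j) (n : ℕ) (s : ℝ) (hs : 0 ≤ s) :
    gcpPmf k lam n s ≤ 1 := by
  rw [gcp_eq]
  have h := S_F (fun j => lam j * s) fun j => mul_nonneg (hl j).le hs
  have h1 := le_hasSum h.2 n (fun m _ => h.1 m)
  rw [← Finset.sum_mul] at h1
  calc _ ≤ Real.exp (-((∑ j, lam j) * s)) * Real.exp ((∑ j, lam j) * s) := by gcongr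
    _ = 1 := by rw [← Real.exp_add]; simp

/-- dominating sequence -/
noncomputable def G {k : ℕ} (mu : Fin k → ℝ) (T : ℝ) (n : ℕ) : ℝ :=
  Real.exp ((∑ j, mu j) * T) * coeff n (F (fun j => mu j * T))

lemma abs_gcp_le {k : ℕ} (mu : Fin k → ℝ) (hm : ∀ j, 0 < mu j) (n : ℕ) (t T : ℝ) (h : |t| ≤ T) :
    |gcpPmf k mu n t| ≤ G mu T n := by
  rw [gcp_eq, abs_mul, Real.abs_exp, G]
  have hM : 0 ≤ ∑ j, mu j := Finset.sum_nonneg fun j _ => (hm j).le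
  refine mul_le_mul (Real.exp_le_exp.2 ?_) (abs_coeff_F_le _ _ (fun j => ?_) n) (abs_nonneg _)
    (Real.exp_pos _).le
  · rw [← mul_neg]
    exact mul_le_mul_of_nonneg_left ((neg_le_abs t).trans h) hM
  · rw [abs_mul, abs_of_pos (hm j)]
    exact mul_le_mul_of_nonneg_left h (hm j).le

lemma G_summable {k : ℕ} (mu : Fin k → ℝ) (hm : ∀ j, 0 < mu j) (T : ℝ) (hT : 0 ≤ T) :
    Summable (G mu T) :=
  ((S_F _ fun j => mul_nonneg (hm j).le hT).2.summable).mul_left _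

lemma summable_c {k : ℕ} (mu : Fin k → ℝ) (hm : ∀ j, 0 < mu j) (t : ℝ) (c : ℕ → ℝ)
    (hc : ∀ m, |c m| ≤ 1) : Summable (fun m => c m * gcpPmf k mu m t) := by
  refine Summable.of_norm_bounded (G_summable mu hm |t| (abs_nonneg _)) fun m => ?_
  rw [Real.norm_eq_abs, abs_mul]
  calc |c m| * |gcpPmf k mu m t| ≤ 1 * G mu |t| m := by
        gcongr
        · exact hc m
        · exact abs_gcp_le mu hm m t _ le_rfl
    _ = _ := one_mul _

lemma hasSum_shift {f : ℕ → ℝ} {v : ℝ} (d : ℕ) (h : HasSum f v) :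
    HasSum (fun m => if d ≤ m then f (m - d) else 0) v := by
  have hi : Function.Injective (fun m : ℕ => m + d) := add_left_injective d
  rw [← hi.hasSum_iff]
  · convert h using 1
    funext m
    simp
  · intro m hm
    rw [if_neg]
    intro hd
    exact hm ⟨m - d, by simp [hd]⟩

lemma deriv_tsum {k : ℕ} (mu : Fin k → ℝ) (hm : ∀ j, 0 < mu j) (t : ℝ) (c : ℕ → ℝ)
    (hc : ∀ m, |c m| ≤ 1) :
    HasDerivAt (fun τ => ∑' m, c m * gcpPmf k mu m τ)
      (-(∑ j, mu j) * (∑' m, c m * gcpPmf k mu m t) +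
        ∑ j : Fin k, mu j * ∑' m, c (m + ((j : ℕ) + 1)) * gcpPmf k mu m t) t := by
  have hM : 0 ≤ ∑ j, mu j := Finset.sum_nonneg fun j _ => (hm j).le
  set T := |t| + 1 with hT
  have hT0 : 0 ≤ T := by positivity
  have hG := G_summable mu hm T hT0
  have key : HasDerivAt (fun τ => ∑' m, c m * gcpPmf k mu m τ)
      (∑' m, c m * (-(∑ j, mu j) * gcpPmf k mu m t +
        ∑ j : Fin k, mu j *
          (if (j : ℕ) + 1 ≤ m then gcpPmf k mu (m - ((j : ℕ) + 1)) t else 0))) t := by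
    refine hasDerivAt_tsum_of_isPreconnected
      (u := fun m => (∑ j, mu j) * G mu T m + ∑ j : Fin k, mu j *
        (if (j : ℕ) + 1 ≤ m then G mu T (m - ((j : ℕ) + 1)) else 0))
      (g' := fun m t => c m * (-(∑ j, mu j) * gcpPmf k mu m t +
        ∑ j : Fin k, mu j *
          (if (j : ℕ) + 1 ≤ m then gcpPmf k mu (m - ((j : ℕ) + 1)) t else 0)))
      ?_ Metric.isOpen_ball (convex_ball t 1).isPreconnected
      (fun m y _ => (gcp_hasDeriv mu m y).const_mul (c m)) ?_
      (Metric.mem_ball_self one_pos) (summable_c mu hm t c hc) (Metric.mem_ball_self one_pos)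
    · refine (hG.mul_left _).add (summable_sum fun j _ => ?_)
      exact (hasSum_shift _ hG.hasSum).summable.mul_left _
    · intro m y hy
      have hy' : |y| ≤ T := by
        rw [Metric.mem_ball, Real.dist_eq] at hy
        have := abs_sub_abs_le_abs_sub y t
        linarith
      rw [Real.norm_eq_abs, abs_mul]
      refine (mul_le_of_le_one_left (abs_nonneg _) (hc m)).trans ?_
      refine (abs_add_le _ _).trans (add_le_add ?_ ?_)
      · rw [abs_mul, abs_neg, abs_of_nonneg hM]
        exact mul_le_mul_of_nonneg_left (abs_gcp_le mu hm m y T hy') hM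
      · refine (Finset.abs_sum_le_sum_abs _ _).trans (Finset.sum_le_sum fun j _ => ?_)
        rw [abs_mul, abs_of_pos (hm j)]
        refine mul_le_mul_of_nonneg_left ?_ (hm j).le
        split_ifs
        · exact abs_gcp_le mu hm _ y T hy'
        · simp
  refine key.congr_deriv (HasSum.tsum_eq ?_)
  have h0 := (summable_c mu hm t c hc).hasSum.mul_left (-(∑ j, mu j))
  have h1 : ∀ j : Fin k, HasSum (fun m => mu j * (if (j : ℕ) + 1 ≤ m then
      c (m - ((j : ℕ) + 1) + ((j : ℕ) + 1)) * gcpPmf k mu (m - ((j : ℕ) + 1)) t else 0))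
      (mu j * ∑' m, c (m + ((j : ℕ) + 1)) * gcpPmf k mu m t) := fun j =>
    (hasSum_shift ((j : ℕ) + 1)
      (summable_c mu hm t (fun m => c (m + ((j : ℕ) + 1))) (fun m => hc _)).hasSum).mul_left _
  have h2 := h0.add (hasSum_sum (s := Finset.univ) fun j _ => h1 j)
  have hfe : ∀ f g : ℕ → ℝ, ∀ v : ℝ, (∀ m, f m = g m) → HasSum g v → HasSum f v := by
    intro f g v hfg hg
    rw [funext hfg]
    exact hg
  refine hfe _ _ _ (fun m => ?_) h2
  rw [mul_add, Finset.mul_sum]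
  congr 1
  · ring
  · apply Finset.sum_congr rfl
    intro j _
    split_ifs with h
    · rw [Nat.sub_add_cancel h]; ring
    · simp

lemma abs_prod_le {q : ℕ} (K : Fin q → ℕ) (L : (i : Fin q) → Fin (K i) → ℝ)
    (hL : ∀ i j, 0 < L i j) (n : Fin q → ℕ) (m : ℕ) :
    |∏ i : Fin q, gcpPmf (K i) (L i) (n i) m| ≤ 1 := by
  rw [abs_of_nonneg (Finset.prod_nonneg fun i _ => gcp_nonneg _ (hL i) _ _ (Nat.cast_nonneg m))]
  exact Finset.prod_le_one (fun i _ => gcp_nonneg _ (hL i) _ _ (Nat.cast_nonneg m))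
    (fun i _ => gcp_le_one _ (hL i) _ _ (Nat.cast_nonneg m))

lemma tsum_prod_coeff {q : ℕ} (K : Fin q → ℕ) (c : (i : Fin q) → Fin (K i) → ℝ)
    (b : Fin q → ℕ) :
    (∑' x : (i : Fin q) → Fin (K i) → ℕ,
      if (∀ i : Fin q, (∑ j : Fin (K i), ((j : ℕ) + 1) * x i j) = b i) then
        ∏ i : Fin q, ∏ j : Fin (K i), (c i j) ^ (x i j) / (Nat.factorial (x i j)) else 0) =
      ∏ i : Fin q, coeff (b i) (F (c i)) := by
  classical
  simp only [coeff_F, tsum_box]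
  rw [Finset.prod_univ_sum]
  rw [tsum_eq_sum (s := Fintype.piFinset fun i =>
    Fintype.piFinset (fun _ : Fin (K i) => Finset.range (b i + 1)))]
  · apply Finset.sum_congr rfl
    intro x _
    split_ifs with h
    · exact Finset.prod_congr rfl fun i _ => by rw [if_pos (h i)]
    · push Not at h
      obtain ⟨i, hi⟩ := h
      exact (Finset.prod_eq_zero (Finset.mem_univ i) (by rw [if_neg hi])).symm
  · intro x hx
    rw [if_neg]
    intro h
    exact hx (Fintype.mem_piFinset.2 fun i => mem_box (h i))

lemma prod_gcp_eq {q : ℕ} (K : Fin q → ℕ) (L : (i : Fin q) → Fin (K i) → ℝ)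
    (b : Fin q → ℕ) (s : ℝ) :
    ∏ i : Fin q, gcpPmf (K i) (L i) (b i) s =
      Real.exp (-(s * ∑ i : Fin q, ∑ j : Fin (K i), L i j)) *
      ∑' x : (i : Fin q) → Fin (K i) → ℕ,
        if (∀ i : Fin q, (∑ j : Fin (K i), ((j : ℕ) + 1) * x i j) = b i) then
          ∏ i : Fin q, ∏ j : Fin (K i), (s * L i j) ^ (x i j) / (Nat.factorial (x i j))
        else 0 := by
  rw [tsum_prod_coeff K (fun i j => s * L i j) b]
  simp only [gcp_eq, Finset.prod_mul_distrib]
  rw [← Real.exp_sum, Finset.sum_neg_distrib, ← Finset.sum_mul, mul_comm s]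
  simp only [mul_comm s]

lemma gcp_zero {k : ℕ} (lam : Fin k → ℝ) (n : ℕ) :
    gcpPmf k lam n 0 = if n = 0 then 1 else 0 := by
  have : F (fun j => lam j * 0) = 1 := by
    simp only [F, mul_zero]
    apply Finset.prod_eq_one
    intro j _
    simp [E]
  rw [gcp_eq, this, coeff_one]
  simp

lemma prod_gcp_one {q : ℕ} (K : Fin q → ℕ) (L : (i : Fin q) → Fin (K i) → ℝ) (s : ℝ) :
    ∏ i : Fin q, gcpPmf (K i) (L i) 0 s =
      Real.exp (-(s * ∑ i : Fin q, ∑ j : Fin (K i), L i j)) := by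
  have hF : ∀ i, coeff 0 (F (fun j => L i j * s)) = 1 := by
    intro i
    simp only [F, coeff_zero_eq_constantCoeff, map_prod]
    apply Finset.prod_eq_one
    intro j _
    have := coeff_E_mul (j : ℕ) (L i j * s) 0
    simpa using this
  simp only [gcp_eq, hF, mul_one]
  rw [← Real.exp_sum, Finset.sum_neg_distrib, ← Finset.sum_mul, mul_comm s]

lemma shift_eq {q : ℕ} (K : Fin q → ℕ) (L : (i : Fin q) → Fin (K i) → ℝ)
    (hL : ∀ i j, 0 < L i j) {k0 : ℕ} (mu : Fin k0 → ℝ) (hmu : ∀ j0, 0 < mu j0)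
    (n : Fin q → ℕ) (t : ℝ) (d : ℕ) :
    ∑' m : ℕ, (∏ i : Fin q, gcpPmf (K i) (L i) (n i) ((m + d : ℕ) : ℝ)) * gcpPmf k0 mu m t =
      ∑ b ∈ Fintype.piFinset (fun i => Finset.range (n i + 1)),
        mvIgcpPmf q K L k0 mu (fun i => n i - b i) t *
          ∏ i : Fin q, gcpPmf (K i) (L i) (b i) (d : ℝ) := by
  simp only [mvIgcpPmf, ← tsum_mul_right]
  rw [← Summable.tsum_finsetSum]
  · congr 1
    funext m
    push_cast
    simp only [gcp_add]
    rw [Finset.prod_univ_sum, Finset.sum_mul]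
    apply Finset.sum_congr rfl
    intro b _
    rw [Finset.prod_mul_distrib]
    ring
  · intro b _
    exact (summable_c mu hmu t _ (abs_prod_le K L hL _)).mul_right _

end IgcpAux

/-- the system of differential equations governing the state
probabilities of the multivariate IGCP, with initial condition. -/
theorem mvIgcp_de (q : ℕ) (hq : 0 < q) (K : Fin q → ℕ) (hK : ∀ i, 0 < K i)
    (L : (i : Fin q) → Fin (K i) → ℝ) (hL : ∀ i j, 0 < L i j)
    (k0 : ℕ) (hk0 : 0 < k0) (mu : Fin k0 → ℝ) (hmu : ∀ j0, 0 < mu j0)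
    (n : Fin q → ℕ) :
    (∀ t : ℝ, 0 ≤ t →
      HasDerivAt (fun τ : ℝ => mvIgcpPmf q K L k0 mu n τ)
        (-(∑ j0 : Fin k0, mu j0 *
            (1 - Real.exp (-(((j0 : ℕ) + 1 : ℝ) *
              ∑ i : Fin q, ∑ j : Fin (K i), L i j)))) * mvIgcpPmf q K L k0 mu n t +
          ∑' mbar : Fin q → ℕ,
            if ((∀ i : Fin q, mbar i ≤ n i) ∧ mbar ≠ 0) then
              mvIgcpPmf q K L k0 mu (fun i => n i - mbar i) t *
                ∑ j0 : Fin k0, mu j0 *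
                  Real.exp (-(((j0 : ℕ) + 1 : ℝ) *
                    ∑ i : Fin q, ∑ j : Fin (K i), L i j)) *
                  ∑' x : (i : Fin q) → Fin (K i) → ℕ,
                    if (∀ i : Fin q, (∑ j : Fin (K i), ((j : ℕ) + 1) * x i j) = mbar i) then
                      ∏ i : Fin q, ∏ j : Fin (K i),
                        (((j0 : ℕ) + 1 : ℝ) * L i j) ^ (x i j) / (Nat.factorial (x i j))
                    else 0
            else 0) t) ∧
    mvIgcpPmf q K L k0 mu n 0 = if n = 0 then 1 else 0 := by
  classical
  constructor
  · intro t _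
    refine (IgcpAux.deriv_tsum mu hmu t (fun m => ∏ i : Fin q, gcpPmf (K i) (L i) (n i) m)
      (IgcpAux.abs_prod_le K L hL n)).congr_deriv ?_
    have hbox : ∀ b : Fin q → ℕ,
        b ∈ Fintype.piFinset (fun i => Finset.range (n i + 1)) ↔ ∀ i, b i ≤ n i := by
      intro b; simp [Fintype.mem_piFinset, Nat.lt_succ_iff]
    rw [tsum_eq_sum (s := (Fintype.piFinset (fun i => Finset.range (n i + 1))).erase 0)]
    swap
    · intro b hb
      rw [if_neg]
      rintro ⟨h1, h2⟩
      exact hb (Finset.mem_erase.2 ⟨h2, (hbox b).2 h1⟩)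
    have hR : ∀ b ∈ (Fintype.piFinset (fun i => Finset.range (n i + 1))).erase 0,
        (if ((∀ i : Fin q, b i ≤ n i) ∧ b ≠ 0) then
              mvIgcpPmf q K L k0 mu (fun i => n i - b i) t *
                ∑ j0 : Fin k0, mu j0 *
                  Real.exp (-(((j0 : ℕ) + 1 : ℝ) *
                    ∑ i : Fin q, ∑ j : Fin (K i), L i j)) *
                  ∑' x : (i : Fin q) → Fin (K i) → ℕ,
                    if (∀ i : Fin q, (∑ j : Fin (K i), ((j : ℕ) + 1) * x i j) = b i) then
                      ∏ i : Fin q, ∏ j : Fin (K i),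
                        (((j0 : ℕ) + 1 : ℝ) * L i j) ^ (x i j) / (Nat.factorial (x i j))
                    else 0
            else 0) = ∑ j0 : Fin k0, mu j0 * (mvIgcpPmf q K L k0 mu (fun i => n i - b i) t *
              ∏ i : Fin q, gcpPmf (K i) (L i) (b i) ((j0 : ℕ) + 1 : ℝ)) := by
      intro b hb
      rw [Finset.mem_erase, hbox] at hb
      rw [if_pos ⟨hb.2, hb.1⟩, Finset.mul_sum]
      apply Finset.sum_congr rfl
      intro j0 _
      rw [IgcpAux.prod_gcp_eq]
      ring
    rw [Finset.sum_congr rfl hR, Finset.sum_comm]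
    have hS : ∀ j0 : Fin k0, mu j0 * ∑' m : ℕ,
        (∏ i : Fin q, gcpPmf (K i) (L i) (n i) ((m + ((j0 : ℕ) + 1) : ℕ) : ℝ)) *
          gcpPmf k0 mu m t =
        mu j0 * (Real.exp (-(((j0 : ℕ) + 1 : ℝ) * ∑ i : Fin q, ∑ j : Fin (K i), L i j)) *
          mvIgcpPmf q K L k0 mu n t) +
        ∑ b ∈ (Fintype.piFinset (fun i => Finset.range (n i + 1))).erase 0,
          mu j0 * (mvIgcpPmf q K L k0 mu (fun i => n i - b i) t *
              ∏ i : Fin q, gcpPmf (K i) (L i) (b i) ((j0 : ℕ) + 1 : ℝ)) := by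
      intro j0
      rw [IgcpAux.shift_eq K L hL mu hmu n t, ← Finset.add_sum_erase _ _
        ((hbox 0).2 fun i => Nat.zero_le _), ← Finset.mul_sum, mul_add]
      push_cast
      congr 2
      simp only [Pi.zero_apply, Nat.sub_zero]
      rw [IgcpAux.prod_gcp_one, mul_comm]
    rw [Finset.sum_congr rfl fun j0 _ => hS j0, Finset.sum_add_distrib, ← add_assoc]
    congr 1
    change -(∑ j, mu j) * mvIgcpPmf q K L k0 mu n t + _ = _
    simp only [mul_sub, mul_one, Finset.sum_sub_distrib, ← mul_assoc, ← Finset.sum_mul]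
    ring
  · rw [mvIgcpPmf, tsum_eq_single 0]
    · simp only [Nat.cast_zero, IgcpAux.gcp_zero]
      by_cases h : n = 0
      · simp [h]
      · rw [if_neg h]
        obtain ⟨i, hi⟩ := Function.ne_iff.1 h
        rw [Finset.prod_eq_zero (Finset.mem_univ i) (if_neg hi), zero_mul]
    · intro m hm
      rw [IgcpAux.gcp_zero, if_neg hm, mul_zero]
end

section
/- For every n ∈ ℕ₀ and t ≥ 0, q̂^α(n,t) = Σ_{(n₁,…,n_k)∈Ω(k,n)} (Π_{j=1}^k λ_j^{n_j}/n_j!) · Σ_{r₁+⋯+r_{k₀}=z_k} z_k! · (Π_{j₀=1}^{k₀} j₀^{r_{j₀}}/r_{j₀}!) · Σ over all (x₁,…,x_{k₀}) ∈ ℕ₀^{k₀} of (Π_{j₀=1}^{k₀} x_{j₀}^{r_{j₀}} (μ_{j₀} t^α e^{−j₀λ})^{x_{j₀}}/x_{j₀}!) · z_{k₀}! · E_{α, α z_{k₀}+1}^{z_{k₀}+1}(−μ t^α), where z_k = n₁+⋯+n_k and z_{k₀} = x₁+⋯+x_{k₀}. -/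
/-- The three-parameter Mittag-Leffler function
`E_{a,b}^{d}(x) = (1/Γ(d)) ∑_{j=0}^∞ Γ(j+d) x^j/(j! Γ(ja+b))`. -/
noncomputable def mittagLeffler3 (a b d x : ℝ) : ℝ :=
  (1 / Real.Gamma d) *
    ∑' j : ℕ, Real.Gamma (j + d) * x ^ j / (Nat.factorial j * Real.Gamma (j * a + b))

/-- GFCP state probabilities with rates `mu`:
`p₀^α(m,t) = ∑_{r=0}^{m} ∑_{x₁+⋯+x_{k₀}=r, x₁+2x₂+⋯+k₀x_{k₀}=m}
 r!·(∏_{j₀} (μ_{j₀} t^α)^{x_{j₀}}/x_{j₀}!)·E_{α,rα+1}^{r+1}(−μ t^α)`. -/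
noncomputable def gfcpPmf (k0 : ℕ) (mu : Fin k0 → ℝ) (α : ℝ) (m : ℕ) (t : ℝ) : ℝ :=
  ∑ r ∈ Finset.range (m + 1),
    ∑' x : Fin k0 → ℕ,
      if ((∑ j0 : Fin k0, x j0) = r ∧ (∑ j0 : Fin k0, ((j0 : ℕ) + 1) * x j0) = m) then
        (Nat.factorial r : ℝ) *
          (∏ j0 : Fin k0, (mu j0 * t ^ α) ^ (x j0) / (Nat.factorial (x j0))) *
          mittagLeffler3 α (r * α + 1) (r + 1) (-(∑ j0 : Fin k0, mu j0) * t ^ α)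
      else 0

/-- The time-changed IGCP state probabilities: `q̂^α(n,t) = ∑_{m=0}^∞ p(n,m) p₀^α(m,t)`. -/
noncomputable def tcIgcpPmf (k : ℕ) (lam : Fin k → ℝ) (k0 : ℕ) (mu : Fin k0 → ℝ)
    (α : ℝ) (n : ℕ) (t : ℝ) : ℝ :=
  ∑' m : ℕ, gcpPmf k lam n m * gfcpPmf k0 mu α m t

open MeasureTheory in
lemma aux_gamma_lb (s K : ℝ) (hs : 0 ≤ s) (hK : 0 < K) :
    K ^ s * Real.exp (-K) ≤ Real.Gamma (s + 1) := by
  have hs1 : 0 < s + 1 := by linarith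
  have hint := Real.GammaIntegral_convergent hs1
  rw [Real.Gamma_eq_integral hs1, ← integral_exp_neg_Ioi K, ← integral_const_mul]
  have hsub : Set.Ioi K ⊆ Set.Ioi (0 : ℝ) := Set.Ioi_subset_Ioi hK.le
  refine le_trans ?_ (setIntegral_mono_set hint ?_ (Filter.Eventually.of_forall hsub))
  · refine setIntegral_mono_on ((integrableOn_exp_neg_Ioi K).const_mul _)
      (hint.mono_set hsub) measurableSet_Ioi ?_
    intro x hx
    have hx' : K < x := hx
    have : K ^ s ≤ x ^ s := Real.rpow_le_rpow hK.le hx'.le hs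
    have h2 : s + 1 - 1 = s := by ring
    rw [h2, mul_comm]
    exact mul_le_mul_of_nonneg_left this (Real.exp_pos _).le
  · refine (ae_restrict_iff' measurableSet_Ioi).2 (Filter.Eventually.of_forall ?_)
    intro x hx
    have hx' : 0 < x := hx
    show 0 ≤ Real.exp (-x) * x ^ (s + 1 - 1)
    positivity

lemma aux_gamma_lb2 (α M : ℝ) (hα : 0 < α) (hM : 0 < M) :
    ∃ C : ℝ, 0 < C ∧ ∀ N : ℕ, 1 / Real.Gamma (N * α + 1) ≤ C / M ^ N := by
  refine ⟨Real.exp (M ^ (1 / α)), Real.exp_pos _, fun N => ?_⟩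
  have hK : 0 < M ^ (1 / α) := Real.rpow_pos_of_pos hM _
  have h := aux_gamma_lb (N * α) (M ^ (1 / α)) (by positivity) hK
  have e : (M ^ (1 / α)) ^ ((N : ℝ) * α) = M ^ N := by
    rw [← Real.rpow_mul hM.le, ← Real.rpow_natCast]
    congr 1
    field_simp
  rw [e, Real.exp_neg] at h
  have hp : 0 < M ^ N := by positivity
  have hG : 0 < Real.Gamma (N * α + 1) := Real.Gamma_pos_of_pos (by positivity)
  rw [div_le_div_iff₀ hG hp]
  have hE := Real.exp_pos (M ^ (1 / α))
  rw [← div_eq_mul_inv, div_le_iff₀ hE] at h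
  linarith

lemma aux_ml_bound (α M y : ℝ) (hα : 0 < α) (hM : 0 < M) (hy : 4 * |y| ≤ M) :
    ∃ C : ℝ, 0 < C ∧ ∀ r : ℕ,
      |mittagLeffler3 α (r * α + 1) (r + 1) y| ≤ C * (2 / M) ^ r := by
  obtain ⟨C, hC, h⟩ := aux_gamma_lb2 α M hα hM
  refine ⟨C * 2, by positivity, fun r => ?_⟩
  unfold mittagLeffler3
  rw [← tsum_mul_left]
  have hg : HasSum (fun j : ℕ => C * (2 / M) ^ r * (1 / 2 : ℝ) ^ j) (C * (2 / M) ^ r * 2) :=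
    hasSum_geometric_two.mul_left _
  have hb := tsum_of_norm_bounded (f := fun j : ℕ => 1 / Real.Gamma (r + 1) *
    (Real.Gamma (j + (r + 1)) * y ^ j / (Nat.factorial j * Real.Gamma (j * α + (r * α + 1))))) hg ?_
  · rw [Real.norm_eq_abs] at hb
    linarith
  intro j
  have e1 : ((j : ℝ) + (r + 1)) = ((j + r : ℕ) : ℝ) + 1 := by push_cast; ring
  have e2 : ((j : ℝ) * α + (r * α + 1)) = ((j + r : ℕ) : ℝ) * α + 1 := by push_cast; ring
  rw [e1, e2, Real.Gamma_nat_eq_factorial, Real.Gamma_nat_eq_factorial]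
  have hN := h (j + r)
  have hG : 0 < Real.Gamma (((j + r : ℕ) : ℝ) * α + 1) := Real.Gamma_pos_of_pos (by positivity)
  set G := Real.Gamma (((j + r : ℕ) : ℝ) * α + 1) with hGdef
  have hch : ((j + r).choose j : ℝ) = ((j + r).factorial : ℝ) / (j.factorial * r.factorial) := by
    rw [Nat.choose_symm_add, Nat.add_choose, Nat.cast_div (Nat.factorial_mul_factorial_dvd_factorial_add j r)
      (by positivity)]
    push_cast; rfl
  have hch2 : ((j + r).choose j : ℝ) ≤ 2 ^ (j + r) := by
    exact_mod_cast Nat.choose_le_two_pow (j + r) j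
  have e3 : 1 / (r.factorial : ℝ) * (((j + r).factorial : ℝ) * y ^ j / (j.factorial * G))
      = ((j + r).choose j : ℝ) * (1 / G) * y ^ j := by
    rw [hch]
    have := hG.ne'
    field_simp
  rw [e3, norm_mul, norm_mul, Real.norm_of_nonneg (by positivity),
    Real.norm_of_nonneg (by positivity), norm_pow, Real.norm_eq_abs]
  have hyM : |y| / M * 2 ≤ 1 / 2 := by
    rw [div_mul_eq_mul_div, div_le_iff₀ hM]; linarith
  calc ((j + r).choose j : ℝ) * (1 / G) * |y| ^ j
      ≤ 2 ^ (j + r) * (C / M ^ (j + r)) * |y| ^ j := by gcongr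
    _ = C * (2 / M) ^ r * (|y| / M * 2) ^ j := by
      rw [pow_add, pow_add, div_pow, mul_pow, div_pow]
      field_simp
    _ ≤ C * (2 / M) ^ r * (1 / 2) ^ j := by gcongr

lemma aux_multinomial {k0 : ℕ} (x : Fin k0 → ℕ) (v : Fin k0 → ℝ) :
    ((∑ j, x j).factorial : ℝ) * ∏ j, v j ^ x j / ((x j).factorial : ℝ) =
      (Nat.multinomial Finset.univ x : ℝ) * ∏ j, v j ^ x j := by
  rw [← Nat.multinomial_spec Finset.univ x, Finset.prod_div_distrib]
  push_cast
  have : (∏ j, ((x j).factorial : ℝ)) ≠ 0 := Finset.prod_ne_zero_iff.2 fun j _ => by positivity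
  field_simp

lemma aux_summable_multinomial {k0 : ℕ} (v : Fin k0 → ℝ) (hv : ∀ j, 0 ≤ v j)
    (hV : ∑ j, v j < 1) :
    Summable fun x : Fin k0 → ℕ =>
      (Nat.multinomial Finset.univ x : ℝ) * ∏ j, v j ^ x j := by
  have hV0 : 0 ≤ ∑ j, v j := Finset.sum_nonneg fun j _ => hv j
  have hf : ∀ x : Fin k0 → ℕ, 0 ≤ (Nat.multinomial Finset.univ x : ℝ) * ∏ j, v j ^ x j :=
    fun x => mul_nonneg (by positivity) (Finset.prod_nonneg fun j _ => pow_nonneg (hv j) _)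
  refine summable_of_sum_le (c := ∑' r : ℕ, (∑ j, v j) ^ r) hf fun s => ?_
  classical
  rw [← Finset.sum_fiberwise_of_maps_to (g := fun x : Fin k0 → ℕ => ∑ j, x j)
    (t := s.image fun x => ∑ j, x j) (fun x hx => Finset.mem_image_of_mem _ hx)]
  refine le_trans (Finset.sum_le_sum fun r _ => ?_)
    ((summable_geometric_of_lt_one hV0 hV).sum_le_tsum _ fun r _ => pow_nonneg hV0 r)
  rw [Finset.sum_pow_eq_sum_piAntidiag]
  refine Finset.sum_le_sum_of_subset_of_nonneg ?_ fun x _ _ => hf x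
  intro x hx
  rw [Finset.mem_filter] at hx
  rw [Finset.mem_piAntidiag]
  exact ⟨hx.2, fun i _ => Finset.mem_univ i⟩

lemma aux_summable (α : ℝ) (hα : 0 < α) {k0 : ℕ} (w : Fin k0 → ℝ) (hw : ∀ j, 0 ≤ w j) (y : ℝ) :
    Summable fun x : Fin k0 → ℕ =>
      |((∑ j, x j).factorial : ℝ) * (∏ j, w j ^ x j / ((x j).factorial : ℝ)) *
        mittagLeffler3 α ((∑ j, x j : ℕ) * α + 1) ((∑ j, x j : ℕ) + 1) y| := by
  have hW0 : 0 ≤ ∑ j, w j := Finset.sum_nonneg fun j _ => hw j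
  set M : ℝ := 4 * |y| + 2 * (∑ j, w j) + 1 with hMdef
  have hM : 0 < M := by positivity
  obtain ⟨C, hC, h⟩ := aux_ml_bound α M y hα hM (by linarith)
  have hs := aux_summable_multinomial (fun j => w j * (2 / M))
    (fun j => mul_nonneg (hw j) (by positivity)) (by
      rw [← Finset.sum_mul, mul_div_assoc', div_lt_one hM]
      have := abs_nonneg y
      linarith)
  refine Summable.of_nonneg_of_le (fun x => abs_nonneg _) (fun x => ?_) (hs.mul_left C)
  rw [aux_multinomial, abs_mul]
  have hn : 0 ≤ (Nat.multinomial Finset.univ x : ℝ) * ∏ j, w j ^ x j :=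
    mul_nonneg (by positivity) (Finset.prod_nonneg fun j _ => pow_nonneg (hw j) _)
  rw [abs_of_nonneg hn]
  calc _ ≤ (Nat.multinomial Finset.univ x : ℝ) * (∏ j, w j ^ x j) *
        (C * (2 / M) ^ (∑ j, x j)) := mul_le_mul_of_nonneg_left (h _) hn
    _ = _ := by
      simp only [mul_pow]
      rw [Finset.prod_mul_distrib, Finset.prod_pow_eq_pow_sum]
      ring

lemma aux_gfcp (k0 : ℕ) (mu : Fin k0 → ℝ) (α : ℝ) (m : ℕ) (t : ℝ) :
    gfcpPmf k0 mu α m t = ∑' x : Fin k0 → ℕ,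
      if (∑ j : Fin k0, ((j : ℕ) + 1) * x j) = m then
        ((∑ j, x j).factorial : ℝ) * (∏ j, (mu j * t ^ α) ^ x j / ((x j).factorial : ℝ)) *
        mittagLeffler3 α ((∑ j, x j : ℕ) * α + 1) ((∑ j, x j : ℕ) + 1)
          (-(∑ j0 : Fin k0, mu j0) * t ^ α) else 0 := by
  unfold gfcpPmf
  have hfin : ∀ x : Fin k0 → ℕ, (∑ j : Fin k0, ((j : ℕ) + 1) * x j) = m →
      x ∈ Fintype.piFinset fun _ : Fin k0 => Finset.range (m + 1) := by
    intro x hx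
    rw [Fintype.mem_piFinset]
    intro j
    have := Finset.single_le_sum (f := fun j : Fin k0 => ((j : ℕ) + 1) * x j)
      (fun i _ => Nat.zero_le _) (Finset.mem_univ j)
    rw [Finset.mem_range]
    nlinarith [Nat.zero_le ((j : ℕ) * x j)]
  rw [← Summable.tsum_finsetSum]
  · refine tsum_congr fun x => ?_
    by_cases hx : (∑ j : Fin k0, ((j : ℕ) + 1) * x j) = m
    · have hle : ∑ j, x j ≤ m := by
        rw [← hx]
        refine Finset.sum_le_sum fun j _ => ?_
        nlinarith [Nat.zero_le ((j : ℕ) * x j)]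
      simp only [hx, and_true, if_true]
      rw [Finset.sum_ite_eq, if_pos (Finset.mem_range.2 (by omega))]
    · simp [hx]
  · intro r _
    refine summable_of_ne_finset_zero
      (s := Fintype.piFinset fun _ : Fin k0 => Finset.range (m + 1)) fun x hx => ?_
    rw [if_neg]
    rintro ⟨_, h2⟩
    exact hx (hfin x h2)

/-- finite index set containing all solutions of the weighted sum equation -/
def auxBox (k n : ℕ) : Finset (Fin k → ℕ) :=
  (Fintype.piFinset fun _ : Fin k => Finset.range (n + 1)).filter
    fun x => (∑ j : Fin k, ((j : ℕ) + 1) * x j) = n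

lemma aux_mem_box (k n : ℕ) (x : Fin k → ℕ) :
    x ∈ auxBox k n ↔ (∑ j : Fin k, ((j : ℕ) + 1) * x j) = n := by
  unfold auxBox
  rw [Finset.mem_filter, Fintype.mem_piFinset]
  refine ⟨fun h => h.2, fun h => ⟨fun j => ?_, h⟩⟩
  have := Finset.single_le_sum (f := fun j : Fin k => ((j : ℕ) + 1) * x j)
    (fun i _ => Nat.zero_le _) (Finset.mem_univ j)
  rw [Finset.mem_range]
  nlinarith [Nat.zero_le ((j : ℕ) * x j)]

lemma aux_tsum_box (k n : ℕ) (f : (Fin k → ℕ) → ℝ) :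
    (∑' x : Fin k → ℕ, if (∑ j : Fin k, ((j : ℕ) + 1) * x j) = n then f x else 0) =
      ∑ x ∈ auxBox k n, f x := by
  rw [tsum_eq_sum (s := auxBox k n)]
  · exact Finset.sum_congr rfl fun x hx => if_pos ((aux_mem_box k n x).1 hx)
  · intro x hx
    exact if_neg fun h => hx ((aux_mem_box k n x).2 h)

lemma aux_tsum_anti (k z : ℕ) (f : (Fin k → ℕ) → ℝ) :
    (∑' x : Fin k → ℕ, if (∑ j : Fin k, x j) = z then f x else 0) =
      ∑ x ∈ Finset.univ.piAntidiag z, f x := by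
  have hm : ∀ x : Fin k → ℕ, x ∈ Finset.univ.piAntidiag z ↔ ∑ j, x j = z := fun x => by
    rw [Finset.mem_piAntidiag]; simp
  rw [tsum_eq_sum (s := Finset.univ.piAntidiag z)]
  · exact Finset.sum_congr rfl fun x hx => if_pos ((hm x).1 hx)
  · intro x hx
    exact if_neg fun h => hx ((hm x).2 h)

lemma aux_gcp (k : ℕ) (lam : Fin k → ℝ) (n m : ℕ) :
    gcpPmf k lam n m = ∑ nv ∈ auxBox k n,
      (∏ j : Fin k, lam j ^ (nv j) / (Nat.factorial (nv j) : ℝ)) *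
        ((m : ℝ) ^ (∑ j, nv j) * Real.exp (-((∑ j, lam j) * m))) := by
  unfold gcpPmf
  rw [aux_tsum_box]
  refine Finset.sum_congr rfl fun nv _ => ?_
  rw [Finset.prod_mul_distrib, ← Real.exp_sum, Finset.sum_neg_distrib, ← Finset.sum_mul,
    ← mul_assoc]
  congr 1
  rw [← Finset.prod_pow_eq_pow_sum, ← Finset.prod_mul_distrib]
  refine Finset.prod_congr rfl fun j _ => ?_
  rw [mul_pow]; ring

lemma aux_pow_exp_bound (L : ℝ) (hL : 0 < L) (z m : ℕ) :
    (m : ℝ) ^ z * Real.exp (-(L * m)) ≤ (z.factorial : ℝ) / L ^ z := by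
  have h := Real.pow_div_factorial_le_exp (L * m) (by positivity) z
  rw [Real.exp_neg, ← div_eq_mul_inv, div_le_div_iff₀ (Real.exp_pos _) (by positivity)]
  rw [div_le_iff₀ (by positivity), mul_pow] at h
  linarith

/-- explicit state probabilities of the time-changed IGCP in terms of the
three-parameter Mittag-Leffler function. -/
theorem tcIgcp_pmf (k : ℕ) (hk : 0 < k) (lam : Fin k → ℝ) (hlam : ∀ j, 0 < lam j)
    (k0 : ℕ) (hk0 : 0 < k0) (mu : Fin k0 → ℝ) (hmu : ∀ j0, 0 < mu j0)
    (α : ℝ) (hα0 : 0 < α) (hα1 : α < 1) (n : ℕ) (t : ℝ) (ht : 0 ≤ t) :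
    tcIgcpPmf k lam k0 mu α n t =
      ∑' nv : Fin k → ℕ,
        if (∑ j : Fin k, ((j : ℕ) + 1) * nv j) = n then
          (∏ j : Fin k, lam j ^ (nv j) / (Nat.factorial (nv j))) *
            ∑' r : Fin k0 → ℕ,
              if (∑ j0 : Fin k0, r j0) = (∑ j : Fin k, nv j) then
                (Nat.factorial (∑ j : Fin k, nv j) : ℝ) *
                  (∏ j0 : Fin k0, ((j0 : ℕ) + 1 : ℝ) ^ (r j0) / (Nat.factorial (r j0))) *
                  ∑' x : Fin k0 → ℕ,
                    (∏ j0 : Fin k0,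
                        ((x j0 : ℝ) ^ (r j0) *
                          (mu j0 * t ^ α *
                            Real.exp (-(((j0 : ℕ) + 1 : ℝ) * ∑ j : Fin k, lam j))) ^ (x j0) /
                          (Nat.factorial (x j0)))) *
                      ((Nat.factorial (∑ j0 : Fin k0, x j0) : ℝ) *
                        mittagLeffler3 α (α * (∑ j0 : Fin k0, x j0) + 1)
                          ((∑ j0 : Fin k0, x j0) + 1)
                          (-(∑ j0 : Fin k0, mu j0) * t ^ α))
              else 0
        else 0 := by
  set L : ℝ := ∑ j, lam j with hLdef
  have hL : 0 < L := Finset.sum_pos (fun j _ => hlam j) ⟨⟨0, hk⟩, Finset.mem_univ _⟩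
  set w : Fin k0 → ℝ := fun j => mu j * t ^ α with hwdef
  have hw : ∀ j, 0 ≤ w j := fun j => mul_nonneg (hmu j).le (Real.rpow_nonneg ht α)
  set y : ℝ := -(∑ j0 : Fin k0, mu j0) * t ^ α with hydef
  set a : (Fin k0 → ℕ) → ℝ := fun x =>
    ((∑ j, x j).factorial : ℝ) * (∏ j, w j ^ x j / ((x j).factorial : ℝ)) *
        mittagLeffler3 α ((∑ j, x j : ℕ) * α + 1) ((∑ j, x j : ℕ) + 1) y with hadef
  have ha : Summable fun x => |a x| := aux_summable α hα0 w hw y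
  set W : (Fin k0 → ℕ) → ℕ := fun x => ∑ j : Fin k0, ((j : ℕ) + 1) * x j with hWdef
  -- summability of the weighted terms
  have hsW : ∀ z : ℕ, Summable fun x => ((W x : ℝ) ^ z * Real.exp (-(L * W x))) * a x := by
    intro z
    refine Summable.of_norm_bounded (ha.mul_left ((z.factorial : ℝ) / L ^ z)) fun x => ?_
    rw [norm_mul, Real.norm_of_nonneg (by positivity), Real.norm_eq_abs]
    exact mul_le_mul_of_nonneg_right (aux_pow_exp_bound L hL z (W x)) (abs_nonneg _)
  have hsR : ∀ r : Fin k0 → ℕ, Summable fun x : Fin k0 → ℕ =>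
      ((∏ j, (x j : ℝ) ^ r j) * Real.exp (-(L * W x))) * a x := by
    intro r
    have hab : Summable fun x => ((W x : ℝ) ^ (∑ j, r j) * Real.exp (-(L * W x))) * |a x| := by
      refine (hsW (∑ j, r j)).norm.congr fun x => ?_
      rw [norm_mul, Real.norm_of_nonneg (by positivity), Real.norm_eq_abs]
    refine Summable.of_norm_bounded hab fun x => ?_
    rw [norm_mul, Real.norm_of_nonneg
      (mul_nonneg (Finset.prod_nonneg fun j _ => by positivity) (Real.exp_pos _).le),
      Real.norm_eq_abs]
    refine mul_le_mul_of_nonneg_right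
      (mul_le_mul_of_nonneg_right ?_ (Real.exp_pos _).le) (abs_nonneg _)
    rw [← Finset.prod_pow_eq_pow_sum]
    refine Finset.prod_le_prod (fun j _ => by positivity) fun j _ => ?_
    have h1 : x j ≤ W x := by
      have := Finset.single_le_sum (f := fun j : Fin k0 => ((j : ℕ) + 1) * x j)
        (fun i _ => Nat.zero_le _) (Finset.mem_univ j)
      have h2 : x j ≤ ((j : ℕ) + 1) * x j := by nlinarith [Nat.zero_le ((j : ℕ) * x j)]
      exact h2.trans this
    have h3 : (x j : ℝ) ≤ W x := by exact_mod_cast h1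
    gcongr
  -- the left-hand side as a sum over `x`
  have hsG : Summable fun x => gcpPmf k lam n (W x) * a x := by
    have : (fun x => gcpPmf k lam n (W x) * a x) = fun x => ∑ nv ∈ auxBox k n,
        (∏ j : Fin k, lam j ^ (nv j) / (Nat.factorial (nv j) : ℝ)) *
          (((W x : ℝ) ^ (∑ j, nv j) * Real.exp (-(L * W x))) * a x) := by
      funext x
      rw [aux_gcp, Finset.sum_mul]
      exact Finset.sum_congr rfl fun nv _ => by ring
    rw [this]
    exact summable_sum fun nv _ => (hsW _).mul_left _
  have hLHS : tcIgcpPmf k lam k0 mu α n t = ∑' x, gcpPmf k lam n (W x) * a x := by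
    rw [← (hsG.hasSum.tsum_fiberwise W).tsum_eq]
    unfold tcIgcpPmf
    refine tsum_congr fun m => ?_
    rw [aux_gfcp, ← tsum_mul_left,
      tsum_subtype (W ⁻¹' {m}) (fun x => gcpPmf k lam n (W x) * a x)]
    refine tsum_congr fun x => ?_
    by_cases hx : W x = m
    · rw [Set.indicator_of_mem (by simpa using hx), if_pos hx, hx]
    · rw [Set.indicator_of_notMem (by simpa using hx), if_neg hx, mul_zero]
  rw [hLHS, aux_tsum_box]
  have h1 : (fun x => gcpPmf k lam n (W x) * a x) = fun x => ∑ nv ∈ auxBox k n,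
        (∏ j : Fin k, lam j ^ (nv j) / (Nat.factorial (nv j) : ℝ)) *
          (((W x : ℝ) ^ (∑ j, nv j) * Real.exp (-(L * W x))) * a x) := by
    funext x
    rw [aux_gcp, Finset.sum_mul]
    exact Finset.sum_congr rfl fun nv _ => by ring
  rw [h1, Summable.tsum_finsetSum fun nv _ => (hsW _).mul_left _]
  refine Finset.sum_congr rfl fun nv _ => ?_
  rw [tsum_mul_left, aux_tsum_anti]
  congr 1
  generalize (∑ j, nv j) = z
  have h2 : (fun x => ((W x : ℝ) ^ z * Real.exp (-(L * W x))) * a x) = fun x =>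
      ∑ r ∈ Finset.univ.piAntidiag z,
        ((Nat.multinomial Finset.univ r : ℝ) * ∏ j : Fin k0, ((j : ℕ) + 1 : ℝ) ^ r j) *
          (((∏ j, (x j : ℝ) ^ r j) * Real.exp (-(L * W x))) * a x) := by
    funext x
    have e : (W x : ℝ) = ∑ j : Fin k0, ((j : ℕ) + 1 : ℝ) * x j := by
      rw [hWdef]; push_cast; rfl
    have e' : (W x : ℝ) ^ z = ∑ r ∈ Finset.univ.piAntidiag z,
        (Nat.multinomial Finset.univ r : ℝ) * ∏ j : Fin k0, (((j : ℕ) + 1 : ℝ) * x j) ^ r j := by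
      rw [e, Finset.sum_pow_eq_sum_piAntidiag]
    rw [e', Finset.sum_mul, Finset.sum_mul]
    refine Finset.sum_congr rfl fun r _ => ?_
    simp only [mul_pow]
    rw [Finset.prod_mul_distrib]
    ring
  rw [h2, Summable.tsum_finsetSum fun r _ => (hsR r).mul_left _]
  refine Finset.sum_congr rfl fun r hr => ?_
  have hrz : ∑ j, r j = z := (Finset.mem_piAntidiag.1 hr).1
  rw [tsum_mul_left, ← aux_multinomial, hrz]
  congr 1
  refine tsum_congr fun x => ?_
  have e1 : Real.exp (-(L * W x)) =
      ∏ j : Fin k0, Real.exp (-(((j : ℕ) + 1 : ℝ) * L)) ^ x j := by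
    rw [hWdef]
    push_cast
    rw [Finset.mul_sum, ← Finset.sum_neg_distrib, Real.exp_sum]
    refine Finset.prod_congr rfl fun j _ => ?_
    rw [← Real.exp_nat_mul]
    congr 1; ring
  have e2 : (∏ j0 : Fin k0, ((x j0 : ℝ) ^ (r j0) *
      (mu j0 * t ^ α * Real.exp (-(((j0 : ℕ) + 1 : ℝ) * L))) ^ (x j0) /
        (Nat.factorial (x j0)))) = (∏ j, (x j : ℝ) ^ r j) * Real.exp (-(L * W x)) *
          ∏ j, w j ^ x j / ((x j).factorial : ℝ) := by
    rw [e1, ← Finset.prod_mul_distrib, ← Finset.prod_mul_distrib]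
    refine Finset.prod_congr rfl fun j _ => ?_
    rw [mul_pow]
    ring
  rw [e2, hadef]
  push_cast
  rw [mul_comm (∑ j, (x j : ℝ)) α]
  ring
end

section
/- For each n ∈ ℕ₀, the function t ↦ q̂^α(n,t) is differentiable on (0,∞) and satisfies the fractional differential system (d^α/dt^α) q̂^α(n,t) = −μ q̂^α(n,t) + Σ_{j₀=1}^{k₀} μ_{j₀} e^{−j₀λ} Σ_{m=0}^{n} Σ_{(x₁,…,x_k)∈Ω(k,m)} (Π_{j=1}^k (j₀λ_j)^{x_j}/x_j!) q̂^α(n−m,t), with initial condition q̂^α(n,0) = 1 if n = 0 and 0 otherwise. -/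
/-- The Caputo fractional derivative of order `α ∈ (0,1)` of `f` at `t`:
`(1/Γ(1−α)) ∫₀ᵗ (t−s)^{−α} f′(s) ds`. -/
noncomputable def caputoDeriv (α : ℝ) (f : ℝ → ℝ) (t : ℝ) : ℝ :=
  (1 / Real.Gamma (1 - α)) * ∫ s in (0:ℝ)..t, (t - s) ^ (-α) * deriv f s


theorem tc_gamma_lower (A x : ℝ) (hA : 0 < A) (hx : 0 ≤ x) :
    A ^ x * Real.exp (-A) ≤ Real.Gamma (x + 1) := by
  have hI := Real.GammaIntegral_convergent (s := x + 1) (by linarith)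
  rw [Real.Gamma_eq_integral (by linarith)]
  calc A ^ x * Real.exp (-A) = ∫ s in Set.Ioi A, A ^ x * Real.exp (-s) := by
        rw [MeasureTheory.integral_const_mul, integral_exp_neg_Ioi]
    _ ≤ ∫ s in Set.Ioi A, Real.exp (-s) * s ^ (x + 1 - 1) := by
        apply MeasureTheory.setIntegral_mono_on
        · exact (integrableOn_exp_neg_Ioi A).const_mul _
        · exact hI.mono_set (Set.Ioi_subset_Ioi hA.le)
        · exact measurableSet_Ioi
        · intro s hs
          rw [mul_comm, add_sub_cancel_right]
          gcongr
          exact (Set.mem_Ioi.1 hs).le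
    _ ≤ _ := by
        apply MeasureTheory.setIntegral_mono_set hI
        · filter_upwards [MeasureTheory.ae_restrict_mem measurableSet_Ioi] with s hs
          have : 0 < s := hs
          simp only [Pi.zero_apply]
          positivity
        · exact (Set.Ioi_subset_Ioi hA.le).eventuallyLE

theorem tc_summable (α : ℝ) (hα : 0 < α) (C : ℝ) (hC : 0 ≤ C) :
    Summable fun N : ℕ => C ^ N / Real.Gamma (N * α + 1) := by
  obtain ⟨A, hA, hAC⟩ : ∃ A : ℝ, 0 < A ∧ A ^ α = C + 1 := by
    refine ⟨(C + 1) ^ (α⁻¹), by positivity, ?_⟩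
    rw [← Real.rpow_mul (by positivity), inv_mul_cancel₀ hα.ne', Real.rpow_one]
  have hg : Summable fun N : ℕ => Real.exp A * (C / (C + 1)) ^ N :=
    (summable_geometric_of_lt_one (by positivity)
      ((div_lt_one (by positivity)).2 (by linarith))).mul_left _
  refine Summable.of_nonneg_of_le (fun N => ?_) (fun N => ?_) hg
  · have := Real.Gamma_pos_of_pos (s := N * α + 1) (by positivity)
    positivity
  · have h := tc_gamma_lower A (N * α) hA (by positivity)
    rw [mul_comm (N : ℝ) α, Real.rpow_mul hA.le, hAC, Real.rpow_natCast, mul_comm α] at h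
    rw [div_le_iff₀ (Real.Gamma_pos_of_pos (by positivity))]
    calc C ^ N = Real.exp A * (C / (C + 1)) ^ N * ((C + 1) ^ N * Real.exp (-A)) := by
          rw [Real.exp_neg, div_pow]; field_simp
      _ ≤ _ := by gcongr

theorem tc_summable_coef (α : ℝ) (hα : 0 < α) (b : ℕ → ℝ) (K C : ℝ) (hC : 0 ≤ C)
    (hb : ∀ N, |b N| ≤ K * C ^ N) (u : ℝ) :
    Summable fun N : ℕ => |b N| / Real.Gamma (N * α + 1) * |u| ^ N := by
  have hs := (tc_summable α hα (C * |u|) (by positivity)).mul_left K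
  refine Summable.of_nonneg_of_le (fun N => ?_) (fun N => ?_) hs
  · have := Real.Gamma_pos_of_pos (s := N * α + 1) (by positivity)
    positivity
  · have := Real.Gamma_pos_of_pos (s := N * α + 1) (by positivity)
    rw [div_mul_eq_mul_div, ← mul_div_assoc, mul_pow, ← mul_assoc]
    gcongr
    exact hb N

theorem tc_beta (p q t : ℝ) (hp : 0 < p) (hq : 0 < q) (ht : 0 < t) :
    ∫ s in (0:ℝ)..t, (t - s) ^ (q - 1) * s ^ (p - 1) =
      t ^ (p + q - 1) * (Real.Gamma p * Real.Gamma q / Real.Gamma (p + q)) := by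
  have h := Complex.betaIntegral_scaled p q ht
  rw [Complex.betaIntegral_eq_Gamma_mul_div _ _ (by simpa) (by simpa)] at h
  apply Complex.ofReal_injective
  rw [← intervalIntegral.integral_ofReal]
  push_cast [Complex.ofReal_cpow ht.le, Complex.Gamma_ofReal] at *
  rw [← Complex.ofReal_add, Complex.Gamma_ofReal] at h
  rw [← Complex.Gamma_ofReal, ← Complex.Gamma_ofReal, ← Complex.Gamma_ofReal, ← Complex.ofReal_add] at *
  push_cast at *
  rw [← h]
  apply intervalIntegral.integral_congr
  intro s hs
  rw [Set.uIcc_of_le ht.le] at hs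
  simp only
  rw [Complex.ofReal_cpow (by linarith [hs.2]), Complex.ofReal_cpow hs.1]
  push_cast
  ring

theorem tc_beta_int (p q t : ℝ) (hp : 0 < p) (hq : 0 < q) (ht : 0 < t) :
    IntervalIntegrable (fun s => (t - s) ^ (q - 1) * s ^ (p - 1)) MeasureTheory.volume 0 t := by
  by_contra h
  have h1 := tc_beta p q t hp hq ht
  rw [intervalIntegral.integral_undef h] at h1
  have := Real.Gamma_pos_of_pos hp
  have := Real.Gamma_pos_of_pos hq
  have := Real.Gamma_pos_of_pos (add_pos hp hq)
  have : 0 < t ^ (p + q - 1) * (Real.Gamma p * Real.Gamma q / Real.Gamma (p + q)) := by positivity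
  linarith

theorem tc_hasDerivAt (α : ℝ) (hα : 0 < α) (b : ℕ → ℝ) (K C : ℝ) (hC : 0 ≤ C)
    (hb : ∀ N, |b N| ≤ K * C ^ N) (t : ℝ) (ht : 0 < t) :
    HasDerivAt (fun s : ℝ => ∑' N : ℕ, b N / Real.Gamma (N * α + 1) * (s ^ α) ^ N)
      (∑' N : ℕ, b (N + 1) / Real.Gamma ((N + 1) * α) * t ^ ((N + 1) * α - 1)) t := by
  have hK : 0 ≤ K := by simpa using (abs_nonneg _).trans (hb 0)
  set R : ℝ := t ^ α + 1 with hR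
  have htα : 0 < t ^ α := by positivity
  have hF : HasDerivAt (fun u : ℝ => ∑' N : ℕ, b N / Real.Gamma (N * α + 1) * u ^ N)
      (∑' N : ℕ, b N / Real.Gamma (N * α + 1) * (N * (t ^ α) ^ (N - 1))) (t ^ α) := by
    have hsum := (tc_summable α hα (C * (2 * R)) (by positivity)).mul_left K
    refine hasDerivAt_tsum_of_isPreconnected (t := Metric.ball (0:ℝ) R) (y₀ := (0:ℝ))
      (g := fun (N : ℕ) (u : ℝ) => b N / Real.Gamma (N * α + 1) * u ^ N)
      (g' := fun (N : ℕ) (u : ℝ) => b N / Real.Gamma (N * α + 1) * (N * u ^ (N - 1)))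
      hsum Metric.isOpen_ball
      (convex_ball _ _).isPreconnected (fun N y hy => (hasDerivAt_pow N y).const_mul _) ?_ ?_ ?_ ?_
    · intro N y hy
      have hg := Real.Gamma_pos_of_pos (s := N * α + 1) (by positivity)
      have hy' : |y| ≤ R := by simpa using (Metric.mem_ball.1 hy).le
      have h2 : (N : ℝ) * |y| ^ (N - 1) ≤ (2 * R) ^ N := by
        rw [mul_pow]
        have h3 : (N : ℝ) ≤ 2 ^ N := by exact_mod_cast (Nat.lt_two_pow_self).le
        have h4 : |y| ^ (N - 1) ≤ R ^ N :=
          (pow_le_pow_left₀ (abs_nonneg _) hy' _).trans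
            (pow_le_pow_right₀ (by linarith) (Nat.sub_le _ _))
        gcongr
      rw [norm_mul, norm_div, norm_mul, norm_pow, Real.norm_eq_abs, Real.norm_eq_abs,
        Real.norm_eq_abs, Real.norm_eq_abs, abs_of_pos hg, Nat.abs_cast,
        div_mul_eq_mul_div, ← mul_div_assoc, mul_pow C, ← mul_assoc K]
      exact div_le_div_of_nonneg_right
        (mul_le_mul (hb N) h2 (by positivity) (by positivity)) hg.le
    · exact Metric.mem_ball_self (by positivity)
    · exact summable_of_ne_finset_zero (s := {0}) (fun N hN => by
        have : N ≠ 0 := by simpa using hN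
        simp [this])
    · simp only [Metric.mem_ball, dist_zero_right, Real.norm_eq_abs, abs_of_pos htα, hR]
      linarith
  have h1 := (Real.hasDerivAt_rpow_const (x := t) (p := α) (Or.inl ht.ne'))
  have h2 := HasDerivAt.comp t hF h1
  refine h2.congr_deriv ?_
  rw [← tsum_mul_right]
  set g : ℕ → ℝ := fun N => b N / Real.Gamma (N * α + 1) * (N * (t ^ α) ^ (N - 1)) *
    (α * t ^ (α - 1)) with hg
  have e : ∀ N : ℕ, g (N + 1) = b (N + 1) / Real.Gamma ((N + 1) * α) * t ^ ((N + 1) * α - 1) := by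
    intro N
    simp only [hg]
    have hpos : 0 < ((N : ℝ) + 1) * α := by positivity
    have hgg := Real.Gamma_pos_of_pos hpos
    push_cast
    rw [Real.Gamma_add_one hpos.ne', ← Real.rpow_natCast, ← Real.rpow_mul ht.le,
      show ((N : ℝ) + 1) * α - 1 = α * N + (α - 1) by ring, Real.rpow_add ht]
    field_simp
  simp_rw [← e]
  symm
  refine (Nat.succ_injective).tsum_eq (f := g) ?_
  intro N hN
  cases N with
  | zero => simp [hg] at hN
  | succ N => exact ⟨N, rfl⟩

theorem tc_caputo (α : ℝ) (hα : 0 < α) (hα1 : α < 1) (b : ℕ → ℝ) (K C : ℝ) (hC : 0 ≤ C)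
    (hb : ∀ N, |b N| ≤ K * C ^ N) (f : ℝ → ℝ)
    (hf : ∀ s, 0 < s → deriv f s =
      ∑' N : ℕ, b (N + 1) / Real.Gamma ((N + 1) * α) * s ^ ((N + 1) * α - 1))
    (t : ℝ) (ht : 0 < t) :
    (1 / Real.Gamma (1 - α)) * ∫ s in (0:ℝ)..t, (t - s) ^ (-α) * deriv f s
      = ∑' N : ℕ, b (N + 1) / Real.Gamma (N * α + 1) * (t ^ α) ^ N := by
  have hK : 0 ≤ K := by simpa using (abs_nonneg _).trans (hb 0)
  have hG1 : 0 < Real.Gamma (1 - α) := Real.Gamma_pos_of_pos (by linarith)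
  let F : ℕ → ℝ → ℝ := fun N s => b (N + 1) / Real.Gamma ((N + 1) * α) *
    ((t - s) ^ (-α) * s ^ ((N + 1) * α - 1))
  have hbeta : ∀ N : ℕ, ∫ s in (0:ℝ)..t, (t - s) ^ (-α) * s ^ ((N + 1) * α - 1) =
      (t ^ α) ^ N * (Real.Gamma ((N + 1) * α) * Real.Gamma (1 - α) / Real.Gamma (N * α + 1)) := by
    intro N
    have := tc_beta ((N + 1) * α) (1 - α) t (by positivity) (by linarith) ht
    rw [show (1 - α - 1) = -α by ring, show ((N : ℝ) + 1) * α + (1 - α) = N * α + 1 by ring,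
      show (N : ℝ) * α + 1 - 1 = α * N by ring, Real.rpow_mul ht.le, Real.rpow_natCast] at this
    exact this
  have hbint : ∀ N : ℕ, IntervalIntegrable (fun s => (t - s) ^ (-α) * s ^ ((N + 1) * α - 1))
      MeasureTheory.volume 0 t := by
    intro N
    have := tc_beta_int ((N + 1) * α) (1 - α) t (by positivity) (by linarith) ht
    rwa [show (1 - α - 1) = -α by ring] at this
  have hFi : ∀ N, MeasureTheory.Integrable (F N)
      (MeasureTheory.volume.restrict (Set.Ioc 0 t)) := fun N =>
    ((intervalIntegrable_iff_integrableOn_Ioc_of_le ht.le).1 (hbint N)).const_mul _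
  have hgN : ∀ N : ℕ, 0 < Real.Gamma ((N + 1) * α) := fun N =>
    Real.Gamma_pos_of_pos (by positivity)
  have hgN1 : ∀ N : ℕ, 0 < Real.Gamma (N * α + 1) := fun N =>
    Real.Gamma_pos_of_pos (by positivity)
  have hFint : ∀ N, ∫ s in Set.Ioc 0 t, F N s =
      Real.Gamma (1 - α) * (b (N + 1) / Real.Gamma (N * α + 1) * (t ^ α) ^ N) := by
    intro N
    rw [MeasureTheory.integral_const_mul, ← intervalIntegral.integral_of_le ht.le, hbeta]
    have := hgN N
    have := hgN1 N
    field_simp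
  have hFnorm : ∀ N, ∫ s in Set.Ioc 0 t, ‖F N s‖ =
      Real.Gamma (1 - α) * (|b (N + 1)| / Real.Gamma (N * α + 1) * |t ^ α| ^ N) := by
    intro N
    have : ∫ s in Set.Ioc 0 t, ‖F N s‖ = ∫ s in Set.Ioc 0 t, |b (N + 1)| / Real.Gamma ((N + 1) * α) *
        ((t - s) ^ (-α) * s ^ ((N + 1) * α - 1)) := by
      apply MeasureTheory.setIntegral_congr_fun measurableSet_Ioc
      intro s hs
      have h0 : 0 ≤ (t - s) ^ (-α) := Real.rpow_nonneg (by linarith [hs.2]) _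
      have h1 : 0 ≤ s ^ (((N : ℝ) + 1) * α - 1) := Real.rpow_nonneg hs.1.le _
      simp only [F, Real.norm_eq_abs, abs_mul, abs_div, abs_of_pos (hgN N), abs_of_nonneg h0,
        abs_of_nonneg h1]
    rw [this, MeasureTheory.integral_const_mul, ← intervalIntegral.integral_of_le ht.le, hbeta,
      abs_of_pos (by positivity : 0 < t ^ α)]
    have := hgN N
    have := hgN1 N
    field_simp
  have hsum : Summable fun N => ∫ s in Set.Ioc 0 t, ‖F N s‖ := by
    simp_rw [hFnorm]
    refine Summable.mul_left _ ?_
    refine tc_summable_coef α hα (fun N => b (N + 1)) (K * C) C hC (fun N => ?_) _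
    have := hb (N + 1)
    rw [pow_succ'] at this
    linarith
  have key := MeasureTheory.hasSum_integral_of_summable_integral_norm hFi hsum
  have h3 : ∫ s in (0:ℝ)..t, (t - s) ^ (-α) * deriv f s = ∫ s in Set.Ioc 0 t, ∑' N, F N s := by
    rw [intervalIntegral.integral_of_le ht.le]
    apply MeasureTheory.setIntegral_congr_fun measurableSet_Ioc
    intro s hs
    simp only
    rw [hf s hs.1, ← tsum_mul_left]
    refine tsum_congr fun N => ?_
    simp only [F]
    ring
  rw [h3, ← key.tsum_eq]
  simp_rw [hFint]
  rw [tsum_mul_left]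
  field_simp

noncomputable def tcWt (k n : ℕ) : Finset (Fin k → ℕ) :=
  (Fintype.piFinset fun _ => Finset.range (n + 1)).filter
    (fun x => (∑ j : Fin k, ((j : ℕ) + 1) * x j) = n)

theorem tc_mem_wt (k n : ℕ) (x : Fin k → ℕ) :
    x ∈ tcWt k n ↔ (∑ j : Fin k, ((j : ℕ) + 1) * x j) = n := by
  simp only [tcWt, Finset.mem_filter, Fintype.mem_piFinset, Finset.mem_range, and_iff_right_iff_imp]
  intro h j
  have h1 : ((j : ℕ) + 1) * x j ≤ ∑ j : Fin k, ((j : ℕ) + 1) * x j :=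
    Finset.single_le_sum (f := fun j : Fin k => ((j : ℕ) + 1) * x j)
      (fun _ _ => Nat.zero_le _) (Finset.mem_univ j)
  nlinarith [Nat.zero_le ((j : ℕ) * x j)]

theorem tc_tsum_wt (k n : ℕ) (g : (Fin k → ℕ) → ℝ) :
    (∑' x : Fin k → ℕ, if (∑ j : Fin k, ((j : ℕ) + 1) * x j) = n then g x else 0) =
      ∑ x ∈ tcWt k n, g x := by
  rw [tsum_eq_sum (s := tcWt k n)]
  · exact Finset.sum_congr rfl fun x hx => if_pos ((tc_mem_wt k n x).1 hx)
  · intro x hx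
    exact if_neg (fun h => hx ((tc_mem_wt k n x).2 h))

theorem tc_binom (l s t : ℝ) (n : ℕ) :
    (l * (s + t)) ^ n / (Nat.factorial n) * Real.exp (-(l * (s + t))) =
      ∑ p ∈ Finset.HasAntidiagonal.antidiagonal n,
        ((l * s) ^ p.1 / (Nat.factorial p.1) * Real.exp (-(l * s))) *
        ((l * t) ^ p.2 / (Nat.factorial p.2) * Real.exp (-(l * t))) := by
  rw [mul_add, neg_add, Real.exp_add, (Commute.all (l * s) (l * t)).add_pow', Finset.sum_div,
    Finset.sum_mul]
  refine Finset.sum_congr rfl fun p hp => ?_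
  rw [Finset.HasAntidiagonal.mem_antidiagonal] at hp
  have h := Nat.add_choose_mul_factorial_mul_factorial p.1 p.2
  rw [← Nat.choose_symm_add, hp] at h
  have h' : (n.choose p.1 : ℝ) * p.1.factorial * p.2.factorial = n.factorial := by exact_mod_cast h
  rw [← h', nsmul_eq_mul]
  have : (n.choose p.1 : ℝ) ≠ 0 := by
    exact_mod_cast (Nat.choose_pos (by omega)).ne'
  have := Nat.factorial_ne_zero p.1
  have := Nat.factorial_ne_zero p.2
  field_simp

theorem tc_gcp_add (k : ℕ) (lam : Fin k → ℝ) (n : ℕ) (s t : ℝ) :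
    gcpPmf k lam n (s + t) =
      ∑ l ∈ Finset.range (n + 1), gcpPmf k lam l s * gcpPmf k lam (n - l) t := by
  simp only [gcpPmf, tc_tsum_wt, tc_binom, Finset.prod_univ_sum, Finset.sum_mul_sum,
    ← Finset.sum_product', ← Finset.prod_mul_distrib]
  rw [Finset.sum_sigma', Finset.sum_sigma']
  refine Finset.sum_bij'
    (fun a _ => ⟨∑ j : Fin k, ((j : ℕ) + 1) * (a.2 j).1, (fun j => (a.2 j).1, fun j => (a.2 j).2)⟩)
    (fun a _ => ⟨fun j => a.2.1 j + a.2.2 j, fun j => (a.2.1 j, a.2.2 j)⟩) ?_ ?_ ?_ ?_ ?_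
  · rintro ⟨x, p⟩ h
    simp only [Finset.mem_sigma, tc_mem_wt, Fintype.mem_piFinset, Finset.HasAntidiagonal.mem_antidiagonal,
      Finset.mem_product, Finset.mem_range, true_and] at h ⊢
    obtain ⟨h1, h2⟩ := h
    have h3 : (∑ j : Fin k, ((j : ℕ) + 1) * (p j).1) + (∑ j : Fin k, ((j : ℕ) + 1) * (p j).2) = n := by
      rw [← Finset.sum_add_distrib, ← h1]
      refine Finset.sum_congr rfl fun j _ => ?_
      rw [← h2 j]; ring
    omega
  · rintro ⟨l, y, z⟩ h
    simp only [Finset.mem_sigma, tc_mem_wt, Fintype.mem_piFinset, Finset.HasAntidiagonal.mem_antidiagonal,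
      Finset.mem_product, Finset.mem_range, implies_true, and_true] at h ⊢
    simp only [mul_add, Finset.sum_add_distrib]
    omega
  · rintro ⟨x, p⟩ h
    simp only [Finset.mem_sigma, Fintype.mem_piFinset, Finset.HasAntidiagonal.mem_antidiagonal] at h
    have : x = fun j => (p j).1 + (p j).2 := funext fun j => (h.2 j).symm
    subst this
    rfl
  · rintro ⟨l, y, z⟩ h
    simp only [Finset.mem_sigma, tc_mem_wt, Finset.mem_product, Finset.mem_range] at h
    obtain ⟨_, h1, _⟩ := h
    subst h1
    rfl
  · rintro ⟨x, p⟩ h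
    rfl

theorem tc_gcp_bound (k : ℕ) (lam : Fin k → ℝ) (hlam : ∀ j, 0 < lam j) (n : ℕ) (m : ℕ) :
    |gcpPmf k lam n m| ≤ (tcWt k n).card := by
  have hf : ∀ (j : Fin k) (a : ℕ), 0 ≤ (lam j * m) ^ a / (Nat.factorial a) * Real.exp (-(lam j * m)) := by
    intro j a
    have := hlam j
    positivity
  rw [gcpPmf, tc_tsum_wt, abs_of_nonneg (Finset.sum_nonneg fun x _ => Finset.prod_nonneg fun j _ => hf j _)]
  have hc : ((tcWt k n).card : ℝ) = ∑ x ∈ tcWt k n, (1 : ℝ) := by simp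
  rw [hc]
  refine Finset.sum_le_sum fun x _ => Finset.prod_le_one (fun j _ => hf j _) fun j _ => ?_
  have h0 : 0 ≤ lam j * m := by have := hlam j; positivity
  rw [Real.exp_neg, ← div_eq_mul_inv, div_le_one (Real.exp_pos _)]
  exact Real.pow_div_factorial_le_exp _ h0 _

theorem tc_gcp_zero (k : ℕ) (lam : Fin k → ℝ) (n : ℕ) :
    gcpPmf k lam n 0 = if n = 0 then 1 else 0 := by
  rw [gcpPmf, tsum_eq_single 0]
  · simp [eq_comm]
  · intro x hx
    obtain ⟨j, hj⟩ := Function.ne_iff.1 hx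
    rw [Finset.prod_eq_zero (Finset.mem_univ j)]
    · simp
    · simp only [Pi.zero_apply] at hj
      simp [hj]

theorem tc_gcp_exp (k : ℕ) (lam : Fin k → ℝ) (n : ℕ) (t : ℝ) :
    Real.exp (-(t * ∑ j : Fin k, lam j)) *
      (∑' x : Fin k → ℕ,
                if (∑ j : Fin k, ((j : ℕ) + 1) * x j) = n then
                  ∏ j : Fin k, (t * lam j) ^ (x j) / (Nat.factorial (x j))
                else 0) = gcpPmf k lam n t := by
  rw [gcpPmf, tc_tsum_wt, tc_tsum_wt, Finset.mul_sum]
  refine Finset.sum_congr rfl fun x _ => ?_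
  rw [Finset.prod_mul_distrib, ← Real.exp_sum, mul_comm, Finset.sum_neg_distrib, Finset.mul_sum]
  simp only [mul_comm]

open Polynomial in
noncomputable def tcQ (k0 : ℕ) (mu : Fin k0 → ℝ) : ℝ[X] :=
  ∑ j : Fin k0, C (mu j) * X ^ ((j : ℕ) + 1)

open Polynomial in
theorem tc_coeff_Q (k0 : ℕ) (mu : Fin k0 → ℝ) (r m : ℕ) :
    ((tcQ k0 mu) ^ r).coeff m =
      ∑' x : Fin k0 → ℕ,
        if ((∑ j0 : Fin k0, x j0) = r ∧ (∑ j0 : Fin k0, ((j0 : ℕ) + 1) * x j0) = m) then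
          (Nat.factorial r : ℝ) * (∏ j0 : Fin k0, (mu j0) ^ (x j0) / (Nat.factorial (x j0)))
        else 0 := by
  rw [tsum_eq_sum (s := Finset.piAntidiag Finset.univ r), tcQ, Finset.sum_pow_eq_sum_piAntidiag,
    finsetSum_coeff]
  · refine Finset.sum_congr rfl fun x hx => ?_
    rw [Finset.mem_piAntidiag] at hx
    have h1 : (∏ i : Fin k0, (C (mu i) * X ^ ((i : ℕ) + 1) : ℝ[X]) ^ x i) =
        C (∏ i, mu i ^ x i) * X ^ (∑ j0 : Fin k0, ((j0 : ℕ) + 1) * x j0) := by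
      simp_rw [mul_pow, Finset.prod_mul_distrib, ← pow_mul, Finset.prod_pow_eq_pow_sum, map_prod,
        map_pow]
    rw [h1, ← C_eq_natCast, ← mul_assoc, ← C_mul, coeff_C_mul, coeff_X_pow]
    by_cases hm : (∑ j0 : Fin k0, ((j0 : ℕ) + 1) * x j0) = m
    · rw [if_pos hm.symm, if_pos ⟨hx.1, hm⟩, mul_one]
      have h2 := Nat.multinomial_spec Finset.univ x
      rw [hx.1] at h2
      have h3 : ((∏ i, (x i).factorial : ℕ) : ℝ) * (Nat.multinomial Finset.univ x : ℝ) =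
        r.factorial := by exact_mod_cast h2
      rw [← h3, Finset.prod_div_distrib]
      push_cast
      have : (∏ i, ((x i).factorial : ℝ)) ≠ 0 :=
        Finset.prod_ne_zero_iff.2 fun i _ => by exact_mod_cast Nat.factorial_ne_zero _
      field_simp
    · rw [if_neg (fun h => hm h.symm), if_neg (fun h => hm h.2), mul_zero]
  · intro x hx
    apply if_neg
    rintro ⟨h, -⟩
    exact hx (Finset.mem_piAntidiag.2 ⟨h, fun i _ => Finset.mem_univ i⟩)

theorem tc_coeff_Q_nonneg (k0 : ℕ) (mu : Fin k0 → ℝ) (hmu : ∀ j, 0 < mu j) (r m : ℕ) :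
    0 ≤ ((tcQ k0 mu) ^ r).coeff m := by
  rw [tc_coeff_Q]
  refine tsum_nonneg fun x => ?_
  split_ifs
  · have : 0 ≤ ∏ j0 : Fin k0, (mu j0) ^ (x j0) / (Nat.factorial (x j0)) :=
      Finset.prod_nonneg fun j _ => by have := hmu j; positivity
    positivity
  · exact le_rfl

open Polynomial in
theorem tc_coeff_Q_zero (k0 : ℕ) (mu : Fin k0 → ℝ) (r m : ℕ) (h : m < r) :
    ((tcQ k0 mu) ^ r).coeff m = 0 := by
  have h1 : (X : ℝ[X]) ∣ tcQ k0 mu :=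
    Finset.dvd_sum fun j _ => Dvd.dvd.mul_left (dvd_pow_self _ (Nat.succ_ne_zero _)) _
  exact X_pow_dvd_iff.1 (pow_dvd_pow_of_dvd h1 r) m h

open Polynomial in
theorem tc_coeff_P (k0 : ℕ) (mu : Fin k0 → ℝ) (c : ℝ) (N m : ℕ) :
    ((tcQ k0 mu + C c) ^ N).coeff m =
      ∑ r ∈ Finset.range (m + 1), ((tcQ k0 mu) ^ r).coeff m * (N.choose r * c ^ (N - r)) := by
  have h1 : ((tcQ k0 mu + C c) ^ N).coeff m =
      ∑ r ∈ Finset.range (N + 1), ((tcQ k0 mu) ^ r).coeff m * (N.choose r * c ^ (N - r)) := by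
    rw [add_pow, finsetSum_coeff]
    refine Finset.sum_congr rfl fun r _ => ?_
    rw [← C_eq_natCast, ← C_pow, mul_assoc, ← C_mul, coeff_mul_C, mul_comm (c ^ _)]
  rw [h1, Finset.sum_subset (s₂ := Finset.range (N + m + 1)) (Finset.range_subset_range.2 (by omega)),
    Finset.sum_subset (s₁ := Finset.range (m + 1)) (s₂ := Finset.range (N + m + 1))
      (Finset.range_subset_range.2 (by omega))]
  · intro r _ hr
    rw [tc_coeff_Q_zero _ _ _ _ (by simpa using hr), zero_mul]
  · intro r _ hr
    rw [Nat.choose_eq_zero_of_lt (by simpa using hr)]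
    simp

open Polynomial in
theorem tc_coeff_P_bound (k0 : ℕ) (mu : Fin k0 → ℝ) (hmu : ∀ j, 0 < mu j) (c : ℝ) (N m : ℕ) :
    |((tcQ k0 mu + C c) ^ N).coeff m| ≤ ((tcQ k0 mu + C |c|) ^ N).coeff m := by
  rw [tc_coeff_P, tc_coeff_P]
  refine (Finset.abs_sum_le_sum_abs _ _).trans (Finset.sum_le_sum fun r _ => ?_)
  rw [abs_mul, abs_mul, abs_pow, Nat.abs_cast, abs_of_nonneg (tc_coeff_Q_nonneg k0 mu hmu r m)]

theorem tc_ml (α : ℝ) (hα : 0 < α) (c u : ℝ) (r : ℕ) :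
    HasSum (fun N : ℕ => (N.choose r * c ^ (N - r)) / Real.Gamma (N * α + 1) * u ^ N)
      (u ^ r * mittagLeffler3 α (r * α + 1) (r + 1) (c * u)) := by
  have hsum : Summable (fun N : ℕ => (N.choose r * c ^ (N - r)) / Real.Gamma (N * α + 1) * u ^ N) := by
    refine Summable.of_norm ?_
    have := tc_summable_coef α hα (fun N => N.choose r * c ^ (N - r)) 1 (2 * (1 + |c|))
      (by positivity) (fun N => ?_) u
    · refine this.congr fun N => ?_
      rw [norm_mul, norm_div, norm_pow, Real.norm_eq_abs, Real.norm_eq_abs, Real.norm_eq_abs,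
        abs_of_pos (Real.Gamma_pos_of_pos (by positivity))]
    · rw [one_mul, mul_pow, abs_mul, Nat.abs_cast, abs_pow]
      have h1 : (N.choose r : ℝ) ≤ 2 ^ N := by exact_mod_cast Nat.choose_le_two_pow N r
      have h2 : |c| ^ (N - r) ≤ (1 + |c|) ^ N :=
        (pow_le_pow_left₀ (abs_nonneg _) (by linarith) _).trans
          (pow_le_pow_right₀ (by linarith [abs_nonneg c]) (Nat.sub_le _ _))
      gcongr
  have hinj : Function.Injective (fun j : ℕ => j + r) := add_left_injective r
  have hzero : ∀ N ∉ Set.range (fun j : ℕ => j + r),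
      (N.choose r * c ^ (N - r)) / Real.Gamma (N * α + 1) * u ^ N = 0 := by
    intro N hN
    have : N < r := by
      by_contra h
      exact hN ⟨N - r, by simp only; omega⟩
    rw [Nat.choose_eq_zero_of_lt this]
    simp
  rw [← hinj.hasSum_iff hzero]
  have h2 := (hinj.summable_iff hzero).2 hsum
  have h3 : u ^ r * mittagLeffler3 α (r * α + 1) (r + 1) (c * u) = ∑' j : ℕ,
     ((fun N : ℕ => (N.choose r * c ^ (N - r)) / Real.Gamma (N * α + 1) * u ^ N) ∘
      (fun j : ℕ => j + r)) j := by
    rw [mittagLeffler3, ← mul_assoc, ← tsum_mul_left]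
    refine tsum_congr fun j => ?_
    have e1 : Real.Gamma ((j : ℝ) + (r + 1)) = (j + r).factorial := by
      rw [← Real.Gamma_nat_eq_factorial]; push_cast; ring_nf
    have e2 : Real.Gamma ((r : ℝ) + 1) = r.factorial := Real.Gamma_nat_eq_factorial r
    have h := Nat.add_choose_mul_factorial_mul_factorial j r
    try rw [Nat.choose_symm_add] at h
    have h' : ((j + r).choose r : ℝ) * j.factorial * r.factorial = (j + r).factorial := by
      exact_mod_cast h
    simp only [Function.comp]
    rw [e1, e2, ← h', Nat.add_sub_cancel]
    push_cast
    rw [show (j : ℝ) * α + (r * α + 1) = (j + r) * α + 1 by ring]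
    have := (Real.Gamma_pos_of_pos (s := (j + r) * α + 1) (by positivity)).ne'
    have := Nat.factorial_ne_zero j
    have := Nat.factorial_ne_zero r
    rw [pow_add, mul_pow]
    field_simp
  rw [h3]
  exact h2.hasSum

open Polynomial in
theorem tc_gfcp (k0 : ℕ) (mu : Fin k0 → ℝ) (α : ℝ) (hα : 0 < α) (m : ℕ) (t : ℝ) :
    gfcpPmf k0 mu α m t = ∑' N : ℕ,
      ((tcQ k0 mu + C (-∑ j, mu j)) ^ N).coeff m / Real.Gamma (N * α + 1) * (t ^ α) ^ N := by
  have h1 : gfcpPmf k0 mu α m t = ∑ r ∈ Finset.range (m + 1), ((tcQ k0 mu) ^ r).coeff m *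
      ((t ^ α) ^ r * mittagLeffler3 α (r * α + 1) (r + 1) (-(∑ j0 : Fin k0, mu j0) * t ^ α)) := by
    rw [gfcpPmf]
    refine Finset.sum_congr rfl fun r _ => ?_
    rw [tc_coeff_Q, ← tsum_mul_right]
    refine tsum_congr fun x => ?_
    split_ifs with h
    · have : ∏ j0 : Fin k0, (mu j0 * t ^ α) ^ (x j0) / (Nat.factorial (x j0) : ℝ) =
        (∏ j0 : Fin k0, (mu j0) ^ (x j0) / (Nat.factorial (x j0) : ℝ)) * (t ^ α) ^ r := by
        rw [← h.1, ← Finset.prod_pow_eq_pow_sum, ← Finset.prod_mul_distrib]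
        refine Finset.prod_congr rfl fun j _ => ?_
        rw [mul_pow]; ring
      rw [this]; ring
    · rw [zero_mul]
  have h2 := hasSum_sum (s := Finset.range (m + 1)) (fun r _ =>
    (tc_ml α hα (-(∑ j0 : Fin k0, mu j0)) (t ^ α) r).mul_left (((tcQ k0 mu) ^ r).coeff m))
  rw [h1, ← h2.tsum_eq]
  refine tsum_congr fun N => ?_
  rw [tc_coeff_P, div_mul_eq_mul_div, Finset.sum_mul, Finset.sum_div]
  refine Finset.sum_congr rfl fun r _ => ?_
  ring

open Polynomial in
noncomputable def tcL (k : ℕ) (lam : Fin k → ℝ) (n : ℕ) : ℝ[X] →ₗ[ℝ] ℝ :=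
  Polynomial.lsum (fun m => (gcpPmf k lam n m) • LinearMap.id)

open Polynomial in
theorem tc_L_hasSum (k : ℕ) (lam : Fin k → ℝ) (n : ℕ) (f : ℝ[X]) :
    HasSum (fun m : ℕ => gcpPmf k lam n m * f.coeff m) (tcL k lam n f) := by
  have : tcL k lam n f = ∑ m ∈ f.support, gcpPmf k lam n m * f.coeff m := by
    simp [tcL, Polynomial.lsum_apply, Polynomial.sum_def]
  rw [this]
  apply hasSum_sum_of_ne_finset_zero
  intro m hm
  rw [notMem_support_iff.1 hm, mul_zero]

open Polynomial in
theorem tc_L_X_pow (k : ℕ) (lam : Fin k → ℝ) (n j : ℕ) (f : ℝ[X]) :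
    tcL k lam n (X ^ j * f) =
      ∑ l ∈ Finset.range (n + 1), gcpPmf k lam l j * tcL k lam (n - l) f := by
  induction f using Polynomial.induction_on' with
  | add p q hp hq => simp only [mul_add, map_add, hp, hq, Finset.sum_add_distrib]
  | monomial m a =>
    rw [X_pow_mul_monomial]
    have hm : ∀ n m : ℕ, tcL k lam n (monomial m a) = gcpPmf k lam n m * a := by
      intro n m
      simp [tcL, Polynomial.lsum_apply, Polynomial.sum_monomial_index]
    simp only [hm]
    rw [Nat.add_comm m j]
    push_cast
    rw [tc_gcp_add, Finset.sum_mul]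
    simp only [mul_assoc]

open Polynomial in
noncomputable def tcB (k : ℕ) (lam : Fin k → ℝ) (k0 : ℕ) (mu : Fin k0 → ℝ) (n N : ℕ) : ℝ :=
  tcL k lam n ((tcQ k0 mu + C (-∑ j, mu j)) ^ N)

open Polynomial in
theorem tc_B_succ (k : ℕ) (lam : Fin k → ℝ) (k0 : ℕ) (mu : Fin k0 → ℝ) (n N : ℕ) :
    tcB k lam k0 mu n (N + 1) = -(∑ j, mu j) * tcB k lam k0 mu n N +
      ∑ j : Fin k0, mu j * ∑ l ∈ Finset.range (n + 1),
        gcpPmf k lam l ((j : ℕ) + 1 : ℝ) * tcB k lam k0 mu (n - l) N := by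
  simp only [tcB]
  rw [pow_succ', add_mul, map_add, add_comm, ← smul_eq_C_mul, map_smul, smul_eq_mul]
  congr 1
  conv_lhs => rw [tcQ]
  rw [Finset.sum_mul, map_sum]
  refine Finset.sum_congr rfl fun j _ => ?_
  rw [mul_assoc, ← smul_eq_C_mul, map_smul, smul_eq_mul, tc_L_X_pow]
  push_cast
  rfl

open Polynomial in
theorem tc_A_hasSum (k0 : ℕ) (mu : Fin k0 → ℝ) (hmu : ∀ j, 0 < mu j) (N : ℕ) :
    HasSum (fun m : ℕ => ((tcQ k0 mu + C |-∑ j, mu j|) ^ N).coeff m) ((2 * ∑ j, mu j) ^ N) := by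
  have h0 : 0 ≤ ∑ j, mu j := Finset.sum_nonneg fun j _ => (hmu j).le
  have : (2 * ∑ j, mu j) ^ N = ∑ m ∈ ((tcQ k0 mu + C |-∑ j, mu j|) ^ N).support,
      ((tcQ k0 mu + C |-∑ j, mu j|) ^ N).coeff m := by
    have h1 : eval 1 ((tcQ k0 mu + C |-∑ j, mu j|) ^ N) = (2 * ∑ j, mu j) ^ N := by
      rw [abs_neg, abs_of_nonneg h0]
      simp [tcQ, eval_finsetSum, two_mul]
    rw [← h1, eval_eq_sum, Polynomial.sum_def]
    simp
  rw [this]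
  apply hasSum_sum_of_ne_finset_zero
  intro m hm
  exact notMem_support_iff.1 hm

open Polynomial in
theorem tc_B_bound (k : ℕ) (lam : Fin k → ℝ) (hlam : ∀ j, 0 < lam j) (k0 : ℕ) (mu : Fin k0 → ℝ)
    (hmu : ∀ j, 0 < mu j) (n N : ℕ) :
    |tcB k lam k0 mu n N| ≤ (tcWt k n).card * (2 * ∑ j, mu j) ^ N := by
  have h1 := tc_L_hasSum k lam n ((tcQ k0 mu + C (-∑ j, mu j)) ^ N)
  have h2 := (tc_A_hasSum k0 mu hmu N).mul_left ((tcWt k n).card : ℝ)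
  rw [tcB, ← h1.tsum_eq, ← Real.norm_eq_abs]
  refine tsum_of_norm_bounded h2 fun m => ?_
  rw [norm_mul]
  exact mul_le_mul (tc_gcp_bound k lam hlam n m) (tc_coeff_P_bound k0 mu hmu _ N m)
    (norm_nonneg _) (Nat.cast_nonneg _)

open Polynomial in
theorem tc_series (k : ℕ) (lam : Fin k → ℝ) (hlam : ∀ j, 0 < lam j) (k0 : ℕ) (mu : Fin k0 → ℝ)
    (hmu : ∀ j, 0 < mu j) (α : ℝ) (hα : 0 < α) (n : ℕ) (t : ℝ) :
    tcIgcpPmf k lam k0 mu α n t =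
      ∑' N : ℕ, tcB k lam k0 mu n N / Real.Gamma (N * α + 1) * (t ^ α) ^ N := by
  have h0 : 0 ≤ ∑ j, mu j := Finset.sum_nonneg fun j _ => (hmu j).le
  have hg : ∀ N : ℕ, 0 < Real.Gamma (N * α + 1) := fun N => Real.Gamma_pos_of_pos (by positivity)
  have hA := tc_A_hasSum k0 mu hmu
  have hAnn : ∀ N m, 0 ≤ ((tcQ k0 mu + C |-∑ j, mu j|) ^ N).coeff m := fun N m =>
    (abs_nonneg _).trans (tc_coeff_P_bound k0 mu hmu (-∑ j, mu j) N m)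
  let g : ℕ → ℕ → ℝ := fun N m => gcpPmf k lam n m *
    (((tcQ k0 mu + C (-∑ j, mu j)) ^ N).coeff m / Real.Gamma (N * α + 1) * (t ^ α) ^ N)
  let G : ℕ × ℕ → ℝ := fun p => ((tcWt k n).card : ℝ) *
    (((tcQ k0 mu + C |-∑ j, mu j|) ^ p.1).coeff p.2 / Real.Gamma (p.1 * α + 1) * |t ^ α| ^ p.1)
  have hG : Summable G := by
    have hrow : ∀ N : ℕ, HasSum (fun m => G (N, m)) (((tcWt k n).card : ℝ) *
        ((2 * ∑ j, mu j) ^ N / Real.Gamma (N * α + 1) * |t ^ α| ^ N)) := fun N =>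
      (((hA N).div_const _).mul_right _).mul_left _
    rw [summable_prod_of_nonneg]
    · refine ⟨fun N => (hrow N).summable, ?_⟩
      simp only [(hrow _).tsum_eq]
      refine Summable.mul_left _ ?_
      refine (tc_summable α hα (2 * (∑ j, mu j) * |t ^ α|) (by positivity)).congr fun N => ?_
      rw [mul_pow]; ring
    · rintro ⟨N, m⟩
      have := hAnn N m
      have := hg N
      simp only [Pi.zero_apply, G]
      positivity
  have hsum : Summable (Function.uncurry g) := by
    refine Summable.of_norm_bounded hG ?_
    rintro ⟨N, m⟩
    simp only [Function.uncurry, g, G]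
    rw [norm_mul, norm_mul, norm_div, norm_pow, Real.norm_eq_abs, Real.norm_eq_abs,
      Real.norm_eq_abs, Real.norm_eq_abs, abs_of_pos (hg N)]
    have := hg N
    have h1 := tc_gcp_bound k lam hlam n m
    have h2 := tc_coeff_P_bound k0 mu hmu (-∑ j, mu j) N m
    gcongr
  have hcomm := hsum.tsum_comm
  have e1 : tcIgcpPmf k lam k0 mu α n t = ∑' m, ∑' N, g N m := by
    rw [tcIgcpPmf]
    refine tsum_congr fun m => ?_
    rw [tc_gfcp _ _ _ hα, ← tsum_mul_left]
  rw [e1, hcomm]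
  refine tsum_congr fun N => ?_
  have h3 := (((tc_L_hasSum k lam n ((tcQ k0 mu + C (-∑ j, mu j)) ^ N)).div_const
    (Real.Gamma (N * α + 1))).mul_right ((t ^ α) ^ N)).tsum_eq
  rw [tcB, ← h3]
  refine tsum_congr fun m => ?_
  simp only [g]
  ring

/-- the time-changed IGCP state probabilities are differentiable on
`(0,∞)` and solve the Caputo fractional system of differential equations, with initial
condition `q̂^α(n,0) = δ_{n,0}`. -/
theorem tcIgcp_fractional_de (k : ℕ) (hk : 0 < k) (lam : Fin k → ℝ) (hlam : ∀ j, 0 < lam j)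
    (k0 : ℕ) (hk0 : 0 < k0) (mu : Fin k0 → ℝ) (hmu : ∀ j0, 0 < mu j0)
    (α : ℝ) (hα0 : 0 < α) (hα1 : α < 1) (n : ℕ) :
    (∀ t : ℝ, 0 < t → DifferentiableAt ℝ (fun s : ℝ => tcIgcpPmf k lam k0 mu α n s) t) ∧
    (∀ t : ℝ, 0 < t →
      caputoDeriv α (fun s : ℝ => tcIgcpPmf k lam k0 mu α n s) t =
        -(∑ j0 : Fin k0, mu j0) * tcIgcpPmf k lam k0 mu α n t +
          ∑ j0 : Fin k0, mu j0 * Real.exp (-(((j0 : ℕ) + 1 : ℝ) * ∑ j : Fin k, lam j)) *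
            ∑ m ∈ Finset.range (n + 1),
              (∑' x : Fin k → ℕ,
                if (∑ j : Fin k, ((j : ℕ) + 1) * x j) = m then
                  ∏ j : Fin k, (((j0 : ℕ) + 1 : ℝ) * lam j) ^ (x j) / (Nat.factorial (x j))
                else 0) *
              tcIgcpPmf k lam k0 mu α (n - m) t) ∧
    tcIgcpPmf k lam k0 mu α n 0 = if n = 0 then 1 else 0 := by
  have hα := hα0
  have hμ : 0 ≤ ∑ j, mu j := Finset.sum_nonneg fun j _ => (hmu j).le
  have hfun : ∀ n, (fun s : ℝ => tcIgcpPmf k lam k0 mu α n s) = fun s : ℝ =>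
      ∑' N : ℕ, tcB k lam k0 mu n N / Real.Gamma (N * α + 1) * (s ^ α) ^ N := fun n =>
    funext fun s => tc_series k lam hlam k0 mu hmu α hα n s
  have hbd := fun n => tc_B_bound k lam hlam k0 mu hmu n
  have hder := fun n => tc_hasDerivAt α hα (tcB k lam k0 mu n) (tcWt k n).card (2 * ∑ j, mu j)
    (by positivity) (hbd n)
  refine ⟨?_, ?_, ?_⟩
  · intro t ht
    rw [hfun n]
    exact (hder n t ht).differentiableAt
  · intro t ht
    rw [caputoDeriv, tc_caputo α hα hα1 (tcB k lam k0 mu n) (tcWt k n).card (2 * ∑ j, mu j)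
      (by positivity) (hbd n) _ (fun s hs => by rw [hfun n]; exact (hder n s hs).deriv) t ht]
    have hS : ∀ n, HasSum (fun N : ℕ => tcB k lam k0 mu n N / Real.Gamma (N * α + 1) * (t ^ α) ^ N)
        (tcIgcpPmf k lam k0 mu α n t) := by
      intro n
      rw [tc_series k lam hlam k0 mu hmu α hα n t]
      refine Summable.hasSum (Summable.of_norm ?_)
      refine (tc_summable_coef α hα (tcB k lam k0 mu n) (tcWt k n).card (2 * ∑ j, mu j)
        (by positivity) (hbd n) (t ^ α)).congr fun N => ?_
      rw [norm_mul, norm_div, norm_pow, Real.norm_eq_abs, Real.norm_eq_abs, Real.norm_eq_abs,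
        abs_of_pos (Real.Gamma_pos_of_pos (by positivity))]
    have hT := ((hS n).mul_left (-∑ j, mu j)).add (hasSum_sum (s := Finset.univ)
      (fun (j : Fin k0) _ => (hasSum_sum (s := Finset.range (n + 1)) (fun l _ =>
        (hS (n - l)).mul_left (gcpPmf k lam l ((j : ℕ) + 1 : ℝ)))).mul_left (mu j)))
    have e : ∀ j0 : Fin k0, mu j0 * Real.exp (-(((j0 : ℕ) + 1 : ℝ) * ∑ j : Fin k, lam j)) *
            ∑ m ∈ Finset.range (n + 1),
              (∑' x : Fin k → ℕ,
                if (∑ j : Fin k, ((j : ℕ) + 1) * x j) = m then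
                  ∏ j : Fin k, (((j0 : ℕ) + 1 : ℝ) * lam j) ^ (x j) / (Nat.factorial (x j))
                else 0) *
              tcIgcpPmf k lam k0 mu α (n - m) t =
        mu j0 * ∑ l ∈ Finset.range (n + 1), gcpPmf k lam l ((j0 : ℕ) + 1 : ℝ) *
          tcIgcpPmf k lam k0 mu α (n - l) t := by
      intro j0
      rw [mul_assoc, Finset.mul_sum]
      congr 1
      refine Finset.sum_congr rfl fun m _ => ?_
      rw [← mul_assoc, tc_gcp_exp]
    rw [Finset.sum_congr rfl fun j0 _ => e j0, ← hT.tsum_eq]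
    refine tsum_congr fun N => ?_
    rw [tc_B_succ, add_div, add_mul, Finset.sum_div, Finset.sum_mul]
    congr 1
    · ring
    · refine Finset.sum_congr rfl fun j _ => ?_
      rw [mul_div_assoc, mul_assoc, Finset.sum_div, Finset.sum_mul]
      congr 1
      refine Finset.sum_congr rfl fun l _ => ?_
      ring
  · rw [tc_series k lam hlam k0 mu hmu α hα n 0, tsum_eq_single 0]
    · have : tcB k lam k0 mu n 0 = gcpPmf k lam n 0 := by
        rw [tcB, pow_zero, ← Polynomial.C_1, ← Polynomial.monomial_zero_left]
        rw [tcL, Polynomial.lsum_apply, Polynomial.sum_monomial_index] <;> simp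
      rw [this, tc_gcp_zero]
      simp
    · intro N hN
      rw [Real.zero_rpow hα.ne', zero_pow hN, mul_zero]
end
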